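/- Fix positive integers n, ñ, k with ñ ≤ n and k ≥ 2. For every Path_k-join tree T and every Path_k-pathset A (with respect to n and ñ): (I) χ_T(A) ≥ ñ^{(1/(30e))·d·k^{1/d} − d} · μ(A), where d ≥ 1 is the [·]-depth of T; (II) χ_T(A) ≥ ñ^{(1/√(32e))·d·k^{1/(2d)} − d} · μ(A), where d ≥ 1 is the ⟦·⟧-depth of T. -/

import Mathlib

noncomputable section

/-- A finite subgraph of the infinite path `Path_ℤ`, identified with its (finite) edge set:
the integer `i` encodes the edge `{i-1, i}` of `Path_ℤ`. -/
abbrev PGraph := Finset ℤ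

/-- The connected component of the edge `i` in `G`: all edges `j ∈ G` such that every edge
lying between `i` and `j` also belongs to `G`. -/
def comp (G : PGraph) (i : ℤ) : PGraph :=
  G.filter fun j => ∀ l ∈ Finset.Icc (min i j) (max i j), l ∈ G

/-- `Δ(G)`: the number of connected components of `G`. -/
def Delta (G : PGraph) : ℕ := (G.filter fun i => i - 1 ∉ G).card

/-- `λ(G)`: the maximum number of edges of a connected component of `G`. -/
def lam (G : PGraph) : ℕ := G.sup fun i => (comp G i).card

/-- `G ⊖ F`: the union of the connected components of `G` that are vertex-disjoint from `F`.
(The edges `{i-1,i}` and `{f-1,f}` share a vertex iff `|i - f| ≤ 1`.) -/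
def ominus (G F : PGraph) : PGraph :=
  G.filter fun i => ∀ j ∈ comp G i, ∀ f ∈ F, 1 < (j - f).natAbs

/-- `Path_k`: the subgraph of `Path_ℤ` with edges `{i-1,i}` for `1 ≤ i ≤ k`. -/
def pathk (k : ℕ) : PGraph := Finset.Icc 1 (k : ℤ)

/-- `Δ⃗(G_1,…,G_m ∣ F)`. -/
def dvecFrom : PGraph → List PGraph → ℕ
  | _, [] => 0
  | F, G :: L => Delta (ominus G F) + dvecFrom (F ∪ G) L

/-- `Δ⃗(G_1,…,G_m)`. -/
def dvec (L : List PGraph) : ℕ := dvecFrom ∅ L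

def lvecFrom : PGraph → List PGraph → ℕ
  | _, [] => 0
  | F, G :: L => lam (ominus G F) + lvecFrom (F ∪ G) L

/-- `λ⃗(G_1,…,G_m)`. -/
def lvec (L : List PGraph) : ℕ := lvecFrom ∅ L

def ldvecFrom : PGraph → List PGraph → ℕ
  | _, [] => 0
  | F, G :: L => lam (ominus G F) * Delta (ominus G F) + ldvecFrom (F ∪ G) L

/-- `λΔ⃗(G_1,…,G_m)`. -/
def ldvec (L : List PGraph) : ℕ := ldvecFrom ∅ L

/-- The sequence `G_1, …, G_m` as a list. -/
def seqList {m : ℕ} (G : Fin m → PGraph) : List PGraph := (List.finRange m).map G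

/-- `G_1 ∪ ⋯ ∪ G_{j-1}` (the union of the entries strictly before `j`). -/
def unionBelow {m : ℕ} (G : Fin m → PGraph) (j : Fin m) : PGraph :=
  (Finset.univ.filter fun i => i < j).biUnion G

/-- A shift permutation: `σ(j) ≥ j - 1` for all `j`. -/
def IsShiftPerm {m : ℕ} (σ : Equiv.Perm (Fin m)) : Prop :=
  ∀ j : Fin m, (j : ℕ) ≤ (σ j : ℕ) + 1
/-- Join trees: finite binary trees whose leaves are labelled by subgraphs of `Path_ℤ`. -/
inductive JoinTree where
  | leaf : PGraph → JoinTree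
  | node : JoinTree → JoinTree → JoinTree

namespace JoinTree

/-- The graph labelling a node (the label of an internal node is the union of the labels
of its children). -/
def graph : JoinTree → PGraph
  | leaf G => G
  | node T₁ T₂ => T₁.graph ∪ T₂.graph

/-- A join tree is valid if each leaf is labelled by a single-edge graph or by `∅`. -/
def valid : JoinTree → Prop
  | leaf G => G.card ≤ 1
  | node T₁ T₂ => T₁.valid ∧ T₂.valid

/-- The lists `B_1, …, B_ℓ` of sibling labels (top to bottom, ending with the leaf label)
along each root-to-leaf branch. -/
def branches : JoinTree → List (List PGraph)
  | leaf G => [[G]]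
  | node T₁ T₂ =>
    ((branches T₁).map fun b => T₂.graph :: b) ++ ((branches T₂).map fun b => T₁.graph :: b)

end JoinTree

/-- `Ψ(T)`: the maximum of `Δ⃗(C_1,…,C_r)` over all `T`-branch coverings `{C_1,…,C_r}` of the
root graph and all enumerations `C_1,…,C_r` of them. -/
def Psi (T : JoinTree) : ℕ :=
  (T.branches.map fun b => ((b.dedup.permutations).map dvec).foldr max 0).foldr max 0

/-- `[T_1,…,T_m] = T_1 ∪ [T_2,…,T_m]`. -/
def sqComb : (m : ℕ) → (Fin (m + 1) → JoinTree) → JoinTree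
  | 0, T => T 0
  | m + 1, T => JoinTree.node (T 0) (sqComb m fun i => T i.succ)

/-- `⟦T_1,…,T_m⟧ = ⟦T_1,…,T_{m-1}⟧ ∪ ⟦T_1,…,T_{m-2},T_m⟧`. -/
def semComb : (m : ℕ) → (Fin (m + 1) → JoinTree) → JoinTree
  | 0, T => T 0
  | m + 1, T =>
    JoinTree.node (semComb m fun i => T i.castSucc)
      (semComb m fun i => if (i : ℕ) = m then T (Fin.last (m + 1)) else T i.castSucc)

/-- `T` is expressible by nesting `[·]` operations to depth `≤ d`, starting from
single-node join trees. -/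
inductive SqDepthLE : ℕ → JoinTree → Prop
  | base (d : ℕ) (G : PGraph) : SqDepthLE d (JoinTree.leaf G)
  | step (d m : ℕ) (T : Fin (m + 1) → JoinTree) (h : ∀ i, SqDepthLE d (T i)) :
      SqDepthLE (d + 1) (sqComb m T)

/-- The `[·]`-depth of a join tree: the minimum nesting depth of `[·]` operations
required to express it. -/
def sqDepth (T : JoinTree) : ℕ := sInf {d | SqDepthLE d T}

/-- `T` is expressible by nesting `⟦·⟧` operations to depth `≤ d`, starting from
single-node join trees. -/
inductive SemDepthLE : ℕ → JoinTree → Prop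
  | base (d : ℕ) (G : PGraph) : SemDepthLE d (JoinTree.leaf G)
  | step (d m : ℕ) (T : Fin (m + 1) → JoinTree) (h : ∀ i, SemDepthLE d (T i)) :
      SemDepthLE (d + 1) (semComb m T)

/-- The `⟦·⟧`-depth of a join tree: the minimum nesting depth of `⟦·⟧` operations
required to express it. -/
def semDepth (T : JoinTree) : ℕ := sInf {d | SemDepthLE d T}

open Classical

/-- The vertex set of a graph `G ⊂ Path_ℤ` (the edge `i` has endpoints `i-1` and `i`). -/
def verts (G : PGraph) : Finset ℤ := G ∪ G.image fun i => i - 1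

/-- `μ(A)`: the density of a `G`-relation `A ⊆ [n]^{V(G)}`. -/
def mu (n : ℕ) (G : PGraph) (A : Finset (↥(verts G) → Fin n)) : ℝ :=
  (A.card : ℝ) / (n : ℝ) ^ (verts G).card

/-- `μ(A ∣ F)`: the maximum density of `A` conditioned on `F`. -/
def muCond (n : ℕ) (G F : PGraph) (A : Finset (↥(verts G) → Fin n)) : ℝ :=
  ⨆ β : ↥(verts F) → Fin n,
    ((A.filter fun α => ∀ (v : ℤ) (hG : v ∈ verts G) (hF : v ∈ verts F),
        α ⟨v, hG⟩ = β ⟨v, hF⟩).card : ℝ) / (n : ℝ) ^ (verts G \ verts F).card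

/-- A `G`-pathset with respect to the parameters `n` and `ñ`:
`μ(A ∣ F) ≤ (1/ñ)^{Δ(G ⊖ F)}` for every `F ⊆ Path_k`. -/
def IsPathset (n ntil k : ℕ) (G : PGraph) (A : Finset (↥(verts G) → Fin n)) : Prop :=
  ∀ F : PGraph, F ⊆ pathk k → muCond n G F A ≤ (1 / (ntil : ℝ)) ^ Delta (ominus G F)

theorem verts_mono {G H : PGraph} (h : G ⊆ H) : verts G ⊆ verts H :=
  Finset.union_subset_union h (Finset.image_subset_image h)

/-- The join `A ⋈ B` of a `G`-relation and an `H`-relation. -/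
def joinRel (n : ℕ) (G H : PGraph) (A : Finset (↥(verts G) → Fin n))
    (B : Finset (↥(verts H) → Fin n)) :
    Finset (↥(verts (G ∪ H)) → Fin n) :=
  Finset.univ.filter fun γ =>
    (fun v : ↥(verts G) =>
        γ ⟨v.1, verts_mono Finset.subset_union_left v.2⟩) ∈ A ∧
    (fun v : ↥(verts H) =>
        γ ⟨v.1, verts_mono Finset.subset_union_right v.2⟩) ∈ B

/-- Pathset complexity `χ_T(A)`. -/
def chi (n ntil k : ℕ) : (T : JoinTree) → Finset (↥(verts T.graph) → Fin n) → ℕ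
  | .leaf G, A => if G = ∅ ∨ A = ∅ then 0 else 1
  | .node T₁ T₂, A =>
    sInf {s : ℕ |
      ∃ (r : ℕ) (Ai : Fin r → Finset (↥(verts (T₁.graph ∪ T₂.graph)) → Fin n))
        (Bi : Fin r → Finset (↥(verts T₁.graph) → Fin n))
        (Ci : Fin r → Finset (↥(verts T₂.graph) → Fin n)),
        (∀ i, IsPathset n ntil k (T₁.graph ∪ T₂.graph) (Ai i)) ∧
        (∀ i, IsPathset n ntil k T₁.graph (Bi i)) ∧
        (∀ i, IsPathset n ntil k T₂.graph (Ci i)) ∧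
        (∀ i, Ai i ⊆ joinRel n T₁.graph T₂.graph (Bi i) (Ci i)) ∧
        (A ⊆ Finset.univ.biUnion Ai) ∧
        s = ∑ i, max (chi n ntil k T₁ (Bi i)) (chi n ntil k T₂ (Ci i))}

/-- The left end edges of the connected components of `G`. -/
def leftEnds (G : PGraph) : PGraph := G.filter fun i => i - 1 ∉ G

/-- The right end edges of the connected components of `G`. -/
def rightEnds (G : PGraph) : PGraph := G.filter fun i => i + 1 ∉ G

theorem mem_leftEnds {G : PGraph} {i : ℤ} : i ∈ leftEnds G ↔ i ∈ G ∧ i - 1 ∉ G := by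
  simp [leftEnds]

theorem mem_rightEnds {G : PGraph} {i : ℤ} : i ∈ rightEnds G ↔ i ∈ G ∧ i + 1 ∉ G := by
  simp [rightEnds]

theorem card_leftEnds (G : PGraph) : (leftEnds G).card = Delta G := rfl

theorem mem_comp {G : PGraph} {i j : ℤ} :
    j ∈ comp G i ↔ ∀ l, min i j ≤ l → l ≤ max i j → l ∈ G := by
  simp only [comp, Finset.mem_filter, Finset.mem_Icc, and_imp]
  exact ⟨fun h => h.2, fun h => ⟨h j (min_le_right _ _) (le_max_right _ _), h⟩⟩

theorem comp_symm {G : PGraph} {i j : ℤ} (h : j ∈ comp G i) : i ∈ comp G j := by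
  rw [mem_comp] at h ⊢
  rwa [min_comm, max_comm]

theorem comp_trans {G : PGraph} {i j l : ℤ} (h : j ∈ comp G i) (h' : l ∈ comp G j) :
    l ∈ comp G i := by
  rw [mem_comp] at h h' ⊢
  intro x hx hx'
  by_cases hxj : min i j ≤ x ∧ x ≤ max i j
  · exact h x hxj.1 hxj.2
  · exact h' x (by omega) (by omega)

theorem comp_subset (G : PGraph) (i : ℤ) : comp G i ⊆ G := Finset.filter_subset _ _

theorem self_mem_comp {G : PGraph} {i : ℤ} (h : i ∈ G) : i ∈ comp G i := by
  rw [mem_comp]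
  intro l h1 h2
  obtain rfl : l = i := by omega
  exact h

theorem comp_eq_of_mem {G : PGraph} {i j : ℤ} (h : j ∈ comp G i) : comp G j = comp G i := by
  ext x
  exact ⟨fun hx => comp_trans h hx, fun hx => comp_trans (comp_symm h) hx⟩

theorem mem_ominus {G F : PGraph} {i : ℤ} :
    i ∈ ominus G F ↔ i ∈ G ∧ ∀ j ∈ comp G i, ∀ f ∈ F, 1 < (j - f).natAbs := by
  simp [ominus]

theorem ominus_subset (G F : PGraph) : ominus G F ⊆ G := Finset.filter_subset _ _

theorem ominus_anti {G F F' : PGraph} (h : F ⊆ F') : ominus G F' ⊆ ominus G F := by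
  intro i hi
  rw [mem_ominus] at hi ⊢
  exact ⟨hi.1, fun j hj f hf => hi.2 j hj f (h hf)⟩

theorem ominus_eq_empty {G F : PGraph} (h : G ⊆ F) : ominus G F = ∅ := by
  refine Finset.eq_empty_of_forall_notMem fun i hi => ?_
  rw [mem_ominus] at hi
  simpa using hi.2 i (self_mem_comp hi.1) i (h hi.1)

theorem mem_leftEnds_ominus {G F : PGraph} {i : ℤ} :
    i ∈ leftEnds (ominus G F) ↔ i ∈ leftEnds G ∧ i ∈ ominus G F := by
  rw [mem_leftEnds, mem_leftEnds]
  constructor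
  · rintro ⟨h1, h2⟩
    refine ⟨⟨ominus_subset _ _ h1, fun h => h2 ?_⟩, h1⟩
    rw [mem_ominus] at h1 ⊢
    have : i - 1 ∈ comp G i := by
      rw [mem_comp]
      intro l hl hl'
      obtain rfl | rfl : l = i - 1 ∨ l = i := by omega
      · exact h
      · exact h1.1
    rw [comp_eq_of_mem this]
    exact ⟨h, h1.2⟩
  · rintro ⟨h1, h2⟩
    exact ⟨h2, fun h => h1.2 (ominus_subset _ _ h)⟩

/-- The first element of `F` to the right of a gap is a left end. -/
theorem exists_leftEnds_between {F : PGraph} {i f : ℤ} (hf : f ∈ F) (hif : i ≤ f)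
    (hi : i - 1 ∉ F) : ∃ e ∈ leftEnds F, i ≤ e ∧ e ≤ f ∧ ∀ l, i ≤ l → l < e → l ∉ F := by
  have hne : (F.filter fun x => i ≤ x).Nonempty := ⟨f, by simp [hf, hif]⟩
  obtain ⟨e, hm, hmin⟩ := Finset.exists_min_image _ id hne
  simp only [Finset.mem_filter, id] at hm hmin
  refine ⟨e, mem_leftEnds.2 ⟨hm.1, fun h => ?_⟩, hm.2, hmin f ⟨hf, hif⟩, fun l hl hle h => ?_⟩
  · rcases hm.2.lt_or_eq with h' | rfl
    · have := hmin (e - 1) ⟨h, by omega⟩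
      omega
    · exact hi h
  · have := hmin l ⟨h, hl⟩
    omega

/-- The last element of `F` to the left of a gap is a right end. -/
theorem exists_rightEnds_between {F : PGraph} {i f : ℤ} (hf : f ∈ F) (hif : f ≤ i)
    (hi : i + 1 ∉ F) : ∃ e ∈ rightEnds F, e ≤ i ∧ f ≤ e ∧ ∀ l, l ≤ i → e < l → l ∉ F := by
  have hne : (F.filter fun x => x ≤ i).Nonempty := ⟨f, by simp [hf, hif]⟩
  obtain ⟨e, hm, hmax⟩ := Finset.exists_max_image _ id hne
  simp only [Finset.mem_filter, id] at hm hmax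
  refine ⟨e, mem_rightEnds.2 ⟨hm.1, fun h => ?_⟩, hm.2, hmax f ⟨hf, hif⟩, fun l hl hle h => ?_⟩
  · rcases hm.2.lt_or_eq with h' | rfl
    · have := hmax (e + 1) ⟨h, by omega⟩
      omega
    · exact hi h
  · have := hmax l ⟨h, hl⟩
    omega

theorem exists_leftEnds_le {G : PGraph} {i : ℤ} (hi : i ∈ G) :
    ∃ e ∈ leftEnds G, e ≤ i ∧ ∀ l, e ≤ l → l ≤ i → l ∈ G := by
  -- the complement of `G` inside a long enough interval has a last element before `i`
  obtain ⟨m, hm⟩ : ∃ m, ∀ x ∈ G, m < x :=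
    ⟨G.min' ⟨i, hi⟩ - 1, fun x hx => by have := Finset.min'_le G x hx; omega⟩
  have hmi := hm i hi
  obtain ⟨e, he, hei, -, hl⟩ := exists_rightEnds_between (F := Finset.Icc m i \ G) (i := i) (f := m)
    (by simp only [Finset.mem_sdiff, Finset.mem_Icc]
        exact ⟨⟨le_rfl, hmi.le⟩, fun h => lt_irrefl _ (hm m h)⟩) hmi.le (by simp)
  rw [mem_rightEnds] at he
  simp only [Finset.mem_sdiff, Finset.mem_Icc, not_and, not_not, and_imp] at he hl
  have hne : e ≠ i := by rintro rfl; exact he.1.2 hi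
  refine ⟨e + 1, mem_leftEnds.2 ⟨he.2 (by omega) (by omega), by simpa using he.1.2⟩, by omega,
    fun l h1 h2 => hl l h2 (by omega) (by omega) h2⟩

theorem card_rightEnds_le (G : PGraph) : (rightEnds G).card ≤ Delta G := by
  rw [← card_leftEnds]
  refine Finset.card_le_card_of_forall_subsingleton
    (fun i e => e ≤ i ∧ ∀ l, e ≤ l → l ≤ i → l ∈ G) (fun i hi => ?_) (fun e _ i hi j hj => ?_)
  · obtain ⟨e, he, h⟩ := exists_leftEnds_le (mem_rightEnds.1 hi).1
    exact ⟨e, he, h⟩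
  · simp only [Set.mem_ofPred_eq, mem_rightEnds] at hi hj
    rcases lt_trichotomy i j with h | h | h
    · exact absurd (hj.2.2 (i + 1) (by omega) (by omega)) hi.1.2
    · exact h
    · exact absurd (hi.2.2 (j + 1) (by omega) (by omega)) hj.1.2

theorem Delta_pos {G : PGraph} (h : G.Nonempty) : 1 ≤ Delta G := by
  obtain ⟨i, hi⟩ := h
  obtain ⟨e, he, -⟩ := exists_leftEnds_le hi
  exact Finset.card_pos.2 ⟨e, he⟩

theorem Delta_empty : Delta ∅ = 0 := rfl

theorem Delta_union_le (F G : PGraph) : Delta (F ∪ G) ≤ Delta F + Delta (ominus G F) := by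
  have hsub : leftEnds (F ∪ G) ⊆
      (leftEnds (F ∪ G) \ leftEnds (ominus G F)) ∪ leftEnds (ominus G F) := by
    intro x hx
    by_cases h : x ∈ leftEnds (ominus G F) <;> simp [h, hx]
  rw [← card_leftEnds]
  refine (Finset.card_le_card hsub).trans ((Finset.card_union_le _ _).trans ?_)
  rw [card_leftEnds]
  refine Nat.add_le_add_right ?_ _
  rw [← card_leftEnds]
  refine Finset.card_le_card_of_forall_subsingleton
    (fun i f => i ≤ f ∧ ∀ l, i ≤ l → l < f → l ∈ F ∪ G) (fun i hi => ?_) (fun e _ i hi j hj => ?_)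
  · rw [Finset.mem_sdiff, mem_leftEnds, Finset.mem_union, Finset.mem_union, not_or] at hi
    obtain ⟨⟨hi1, hi2, hi3⟩, hi4⟩ := hi
    by_cases hF : i ∈ F
    · exact ⟨i, mem_leftEnds.2 ⟨hF, hi2⟩, le_rfl, fun l h1 h2 => by omega⟩
    · have hG : i ∈ G := hi1.resolve_left hF
      have : ¬ ∀ j ∈ comp G i, ∀ f ∈ F, 1 < (j - f).natAbs := fun h =>
        hi4 (mem_leftEnds_ominus.2 ⟨mem_leftEnds.2 ⟨hG, hi3⟩, mem_ominus.2 ⟨hG, h⟩⟩)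
      push Not at this
      obtain ⟨j, hj, f, hf, hjf⟩ := this
      rw [mem_comp] at hj
      have hij : i ≤ j := by
        by_contra! h
        exact hi3 (hj (i - 1) (by omega) (by omega))
      have hfi : i ≤ f := by
        by_contra! h
        obtain rfl : f = i - 1 := by omega
        exact hi2 hf
      obtain ⟨e, he, hie, hef, -⟩ := exists_leftEnds_between hf hfi hi2
      exact ⟨e, he, hie, fun l h1 h2 => Finset.mem_union_right _ (hj l (by omega) (by omega))⟩
  · simp only [Set.mem_ofPred_eq, Finset.mem_sdiff, mem_leftEnds] at hi hj
    rcases lt_trichotomy i j with h | h | h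
    · exact absurd (hi.2.2 (j - 1) (by omega) (by omega)) hj.1.1.2
    · exact h
    · exact absurd (hj.2.2 (i - 1) (by omega) (by omega)) hi.1.1.2

/-- The union of a list of graphs. -/
def unionL : List PGraph → PGraph
  | [] => ∅
  | G :: L => G ∪ unionL L

theorem mem_unionL {L : List PGraph} {i : ℤ} : i ∈ unionL L ↔ ∃ G ∈ L, i ∈ G := by
  induction L with
  | nil => simp [unionL]
  | cons G L ih => simp [unionL, ih]

theorem subset_unionL {L : List PGraph} {G : PGraph} (h : G ∈ L) : G ⊆ unionL L :=
  fun _ hi => mem_unionL.2 ⟨G, h, hi⟩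

theorem unionL_subset {L : List PGraph} {G : PGraph} (h : ∀ C ∈ L, C ⊆ G) : unionL L ⊆ G := by
  intro i hi
  obtain ⟨C, hC, hi⟩ := mem_unionL.1 hi
  exact h C hC hi

theorem unionL_append (L M : List PGraph) : unionL (L ++ M) = unionL L ∪ unionL M := by
  ext i
  simp only [mem_unionL, List.mem_append, Finset.mem_union]
  constructor
  · rintro ⟨G, h | h, hi⟩
    exacts [Or.inl ⟨G, h, hi⟩, Or.inr ⟨G, h, hi⟩]
  · rintro (⟨G, h, hi⟩ | ⟨G, h, hi⟩)
    exacts [⟨G, Or.inl h, hi⟩, ⟨G, Or.inr h, hi⟩]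

theorem dvecFrom_append (F : PGraph) (L M : List PGraph) :
    dvecFrom F (L ++ M) = dvecFrom F L + dvecFrom (F ∪ unionL L) M := by
  induction L generalizing F with
  | nil => simp [dvecFrom, unionL]
  | cons G L ih => simp [dvecFrom, unionL, ih, Finset.union_assoc, add_assoc]

theorem dvec_append (L M : List PGraph) :
    dvec (L ++ M) = dvec L + dvecFrom (unionL L) M := by
  rw [dvec, dvecFrom_append, Finset.empty_union, dvec]

theorem Delta_union_unionL_le (F : PGraph) (L : List PGraph) :
    Delta (F ∪ unionL L) ≤ Delta F + dvecFrom F L := by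
  induction L generalizing F with
  | nil => simp [dvecFrom, unionL]
  | cons G L ih =>
    rw [unionL, ← Finset.union_assoc, dvecFrom]
    have := ih (F ∪ G)
    have := Delta_union_le F G
    omega

theorem Delta_unionL_le (L : List PGraph) : Delta (unionL L) ≤ dvec L := by
  have := Delta_union_unionL_le ∅ L
  rwa [Finset.empty_union, Delta_empty, zero_add] at this

/-- `H` is a union of connected components of `G`. -/
def IsSaturated (G H : PGraph) : Prop :=
  H ⊆ G ∧ ∀ a ∈ H, ∀ b ∈ G, (a - b).natAbs ≤ 1 → b ∈ H

theorem IsSaturated.sdiff {G H : PGraph} (h : IsSaturated G H) : IsSaturated G (G \ H) := by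
  refine ⟨Finset.sdiff_subset, fun a ha b hb hab => ?_⟩
  rw [Finset.mem_sdiff] at ha ⊢
  exact ⟨hb, fun hbH => ha.2 (h.2 b hbH a ha.1 (by omega))⟩

theorem IsSaturated.mem_of_mem_comp {G H C : PGraph} (h : IsSaturated G H) (hC : C ⊆ G)
    {i j : ℤ} (hi : i ∈ H) (hj : j ∈ comp C i) : j ∈ H := by
  have key : ∀ (m : ℕ) (j : ℤ), (i - j).natAbs = m → j ∈ comp C i → j ∈ H := by
    intro m
    induction m with
    | zero =>
      intro j hij _
      obtain rfl : i = j := by omega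
      exact hi
    | succ m ih =>
      intro j hij hj
      rw [mem_comp] at hj
      have hjG : j ∈ G := hC (hj j (by omega) (by omega))
      rcases lt_or_ge i j with hlt | hge
      · exact h.2 (j - 1) (ih (j - 1) (by omega)
          (mem_comp.2 fun l h1 h2 => hj l (by omega) (by omega))) j hjG (by omega)
      · exact h.2 (j + 1) (ih (j + 1) (by omega)
          (mem_comp.2 fun l h1 h2 => hj l (by omega) (by omega))) j hjG (by omega)
  exact key _ j rfl hj

theorem IsSaturated.leftEnds_ominus_inter_subset {G H C F : PGraph} (h : IsSaturated G H)
    (hC : C ⊆ G) (hF : F ⊆ G) :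
    leftEnds (ominus (C ∩ H) (F ∩ H)) ⊆ leftEnds (ominus C F) ∩ H := by
  intro i hi
  rw [mem_leftEnds_ominus, mem_leftEnds, mem_ominus, Finset.mem_inter] at hi
  obtain ⟨⟨⟨hiC, hiH⟩, hi1⟩, -, hfar⟩ := hi
  rw [Finset.mem_inter, mem_leftEnds_ominus, mem_leftEnds, mem_ominus]
  refine ⟨⟨⟨hiC, fun h1 => hi1 (Finset.mem_inter.2 ⟨h1, h.2 i hiH _ (hC h1) (by omega)⟩)⟩, hiC,
    fun j hj f hf => ?_⟩, hiH⟩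
  by_contra! hjf
  have hjH := h.mem_of_mem_comp hC hiH hj
  have hfH := h.2 j hjH f (hF hf) (by omega)
  have := hfar j (mem_comp.2 fun l h1 h2 => ?_) f (Finset.mem_inter.2 ⟨hf, hfH⟩)
  · omega
  · have hl : l ∈ comp C i := mem_comp.2 fun x hx hx' => mem_comp.1 hj x (by omega) (by omega)
    exact Finset.mem_inter.2 ⟨comp_subset _ _ hl, h.mem_of_mem_comp hC hiH hl⟩

theorem IsSaturated.Delta_ominus_inter_add_le {G H C F : PGraph} (h : IsSaturated G H)
    (hC : C ⊆ G) (hF : F ⊆ G) :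
    Delta (ominus (C ∩ H) (F ∩ H)) + Delta (ominus (C ∩ (G \ H)) (F ∩ (G \ H)))
      ≤ Delta (ominus C F) := by
  simp only [← card_leftEnds]
  rw [← Finset.card_union_of_disjoint]
  · exact Finset.card_le_card (Finset.union_subset
      ((h.leftEnds_ominus_inter_subset hC hF).trans Finset.inter_subset_left)
      ((h.sdiff.leftEnds_ominus_inter_subset hC hF).trans Finset.inter_subset_left))
  · exact Disjoint.mono
      ((h.leftEnds_ominus_inter_subset hC hF).trans Finset.inter_subset_right)
      ((h.sdiff.leftEnds_ominus_inter_subset hC hF).trans Finset.inter_subset_right)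
      Finset.disjoint_sdiff

theorem IsSaturated.dvecFrom_inter_add_le {G H : PGraph} (h : IsSaturated G H)
    {L : List PGraph} {F : PGraph} (hL : ∀ C ∈ L, C ⊆ G) (hF : F ⊆ G) :
    dvecFrom (F ∩ H) (L.map (· ∩ H)) + dvecFrom (F ∩ (G \ H)) (L.map (· ∩ (G \ H)))
      ≤ dvecFrom F L := by
  induction L generalizing F with
  | nil => simp [dvecFrom]
  | cons C L ih =>
    have hC := hL C (by simp)
    have h1 := ih (fun D hD => hL D (by simp [hD])) (Finset.union_subset hF hC)
    have h2 := h.Delta_ominus_inter_add_le hC hF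
    simp only [List.map_cons, dvecFrom]
    rw [Finset.union_inter_distrib_right, Finset.union_inter_distrib_right] at h1
    omega

/-- The components of `G` with left end in a given set. -/
theorem exists_saturated_of_subset_leftEnds {G Λ : PGraph} (hΛ : Λ ⊆ leftEnds G) :
    ∃ H, IsSaturated G H ∧ Λ.card ≤ Delta H ∧ Delta G ≤ Delta (G \ H) + Λ.card ∧
      ∀ e ∈ Λ, comp G e ⊆ H := by
  set H := G.filter fun g => ∃ e ∈ Λ, e ≤ g ∧ ∀ x, e ≤ x → x ≤ g → x ∈ G with hH
  have hmem : ∀ g, g ∈ H ↔ g ∈ G ∧ ∃ e ∈ Λ, e ≤ g ∧ ∀ x, e ≤ x → x ≤ g → x ∈ G := by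
    simp [hH]
  refine ⟨H, ⟨Finset.filter_subset _ _, fun a ha b hb hab => ?_⟩, ?_, ?_, fun e he x hx => ?_⟩
  · rw [hmem] at ha ⊢
    obtain ⟨haG, e, he, hea, hx⟩ := ha
    have he' := mem_leftEnds.1 (hΛ he)
    refine ⟨hb, e, he, ?_, fun x h1 h2 => ?_⟩
    · by_contra! hlt
      obtain rfl : b = e - 1 := by omega
      exact he'.2 hb
    · rcases eq_or_lt_of_le h2 with rfl | h2
      · exact hb
      · exact hx x h1 (by omega)
  · rw [← card_leftEnds]
    refine Finset.card_le_card fun e he => ?_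
    have he' := mem_leftEnds.1 (hΛ he)
    refine mem_leftEnds.2 ⟨(hmem e).2 ⟨he'.1, e, he, le_rfl, fun x h1 h2 => ?_⟩,
      fun h => he'.2 ((hmem _).1 h).1⟩
    obtain rfl : x = e := by omega
    exact he'.1
  · rw [← card_leftEnds, ← card_leftEnds]
    have : leftEnds G ⊆ leftEnds (G \ H) ∪ Λ := by
      intro e he
      by_cases heΛ : e ∈ Λ
      · exact Finset.mem_union_right _ heΛ
      refine Finset.mem_union_left _ ?_
      rw [mem_leftEnds] at he ⊢
      simp only [Finset.mem_sdiff]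
      refine ⟨⟨he.1, fun h => ?_⟩, fun h => he.2 h.1⟩
      obtain ⟨-, l, hl, hle, hx⟩ := (hmem e).1 h
      have : l ≠ e := by rintro rfl; exact heΛ hl
      exact he.2 (hx (e - 1) (by omega) (by omega))
    exact (Finset.card_le_card this).trans (Finset.card_union_le _ _)
  · have he' := mem_leftEnds.1 (hΛ he)
    have hex : e ≤ x := by
      by_contra! hlt
      exact he'.2 (mem_comp.1 hx (e - 1) (by omega) (by omega))
    exact (hmem x).2 ⟨comp_subset _ _ hx, e, he, hex,
      fun y h1 h2 => mem_comp.1 hx y (by omega) (by omega)⟩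

theorem exists_saturated_half (G : PGraph) :
    ∃ H, IsSaturated G H ∧ G.card ≤ 2 * H.card ∧ Delta G ≤ 2 * Delta (G \ H) + 1 := by
  obtain ⟨Λ, hΛ, hcard⟩ := Finset.exists_subset_card_eq (Nat.div_le_self (leftEnds G).card 2)
  obtain ⟨H, hH, h1, h2, -⟩ := exists_saturated_of_subset_leftEnds hΛ
  rw [card_leftEnds] at hcard
  have hsum := Finset.card_sdiff_add_card_eq_card hH.1
  by_cases h : G.card ≤ 2 * H.card
  · exact ⟨H, hH, h, by omega⟩
  · refine ⟨G \ H, hH.sdiff, by omega, ?_⟩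
    rw [Finset.sdiff_sdiff_eq_self hH.1]
    omega

theorem exists_saturated_comp {G : PGraph} {e : ℤ} (he : e ∈ G) :
    ∃ H, IsSaturated G H ∧ (comp G e).card ≤ H.card ∧ Delta G ≤ Delta (G \ H) + 1 := by
  obtain ⟨l, hl, hle, hx⟩ := exists_leftEnds_le he
  obtain ⟨H, hH, -, h2, h3⟩ :=
    exists_saturated_of_subset_leftEnds (Finset.singleton_subset_iff.2 hl)
  refine ⟨H, hH, ?_, by simpa using h2⟩
  have : e ∈ comp G l := mem_comp.2 fun x h1 h2 => hx x (by omega) (by omega)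
  rw [comp_eq_of_mem this]
  exact Finset.card_le_card (h3 l (by simp))

theorem sub_lt_card_comp {G : PGraph} {i j : ℤ} (h : j ∈ comp G i) :
    (i - j).natAbs + 1 ≤ (comp G i).card := by
  have : Finset.Icc (min i j) (max i j) ⊆ comp G i := by
    intro x hx
    rw [Finset.mem_Icc] at hx
    exact mem_comp.2 fun y h1 h2 => mem_comp.1 h y (by omega) (by omega)
  have := Finset.card_le_card this
  rw [Int.card_Icc] at this
  omega

/-- There are few edges outside `F` lying in a small connected set touching `F`. -/
theorem card_le_of_near {E F : PGraph} {M : ℕ}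
    (h : ∀ e ∈ E, e ∉ F ∧ ∃ G : PGraph, (comp G e).card ≤ M ∧
      ∃ j ∈ comp G e, ∃ f ∈ F, (j - f).natAbs ≤ 1) :
    E.card ≤ 2 * M * Delta F := by
  have hsub : E ⊆ ((leftEnds F).biUnion fun f => Finset.Ico (f - M) f) ∪
      ((rightEnds F).biUnion fun f => Finset.Ioc f (f + M)) := by
    intro e he
    obtain ⟨heF, G, hM, j, hj, f, hf, hjf⟩ := h e he
    have hc := sub_lt_card_comp hj
    have hne : f ≠ e := by rintro rfl; exact heF hf
    rw [Finset.mem_union, Finset.mem_biUnion, Finset.mem_biUnion]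
    rcases hne.lt_or_gt with hlt | hlt
    · right
      obtain ⟨x, hx, hxe, hfx, -⟩ := exists_rightEnds_between (i := e - 1) hf (by omega)
        (by simpa using heF)
      exact ⟨x, hx, Finset.mem_Ioc.2 (by omega)⟩
    · left
      obtain ⟨x, hx, hxe, hfx, -⟩ := exists_leftEnds_between (i := e + 1) hf (by omega)
        (by simpa using heF)
      exact ⟨x, hx, Finset.mem_Ico.2 (by omega)⟩
  have h1 : ((leftEnds F).biUnion fun f => Finset.Ico (f - M) f).card ≤ Delta F * M :=
    Finset.card_biUnion_le_card_mul _ _ _ fun f _ => by simp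
  have h2 : ((rightEnds F).biUnion fun f => Finset.Ioc f (f + M)).card ≤
      (rightEnds F).card * M :=
    Finset.card_biUnion_le_card_mul _ _ _ fun f _ => by simp
  have h3 := Nat.mul_le_mul_right M (card_rightEnds_le F)
  have := (Finset.card_le_card hsub).trans (Finset.card_union_le _ _)
  nlinarith

theorem card_filter_comp_lt_le (G : PGraph) (K : ℕ) :
    (G.filter fun e => (comp G e).card < K).card ≤ K * Delta G := by
  have hsub : (G.filter fun e => (comp G e).card < K) ⊆
      (leftEnds G).biUnion fun l => Finset.Ico l (l + K) := by
    intro e he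
    rw [Finset.mem_filter] at he
    obtain ⟨l, hl, hle, hx⟩ := exists_leftEnds_le he.1
    have := sub_lt_card_comp (G := G) (i := e) (j := l)
      (mem_comp.2 fun x h1 h2 => hx x (by omega) (by omega))
    exact Finset.mem_biUnion.2 ⟨l, hl, Finset.mem_Ico.2 (by omega)⟩
  refine (Finset.card_le_card hsub).trans ?_
  rw [mul_comm]
  exact Finset.card_biUnion_le_card_mul _ _ _ fun f _ => by simp

namespace JoinTree

/-- Intersect every label of a join tree with `H`. -/
def restrict (H : PGraph) : JoinTree → JoinTree
  | leaf G => leaf (G ∩ H)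
  | node T₁ T₂ => node (T₁.restrict H) (T₂.restrict H)

theorem graph_restrict (H : PGraph) (T : JoinTree) : (T.restrict H).graph = T.graph ∩ H := by
  induction T with
  | leaf G => rfl
  | node T₁ T₂ ih₁ ih₂ => simp [restrict, graph, ih₁, ih₂, Finset.union_inter_distrib_right]

theorem valid.restrict {T : JoinTree} (h : T.valid) (H : PGraph) : (T.restrict H).valid := by
  induction T with
  | leaf G => exact (Finset.card_le_card Finset.inter_subset_left).trans h
  | node T₁ T₂ ih₁ ih₂ => exact ⟨ih₁ h.1, ih₂ h.2⟩

theorem branches_restrict (H : PGraph) (T : JoinTree) :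
    (T.restrict H).branches = T.branches.map (List.map (· ∩ H)) := by
  induction T with
  | leaf G => rfl
  | node T₁ T₂ ih₁ ih₂ =>
    simp [JoinTree.restrict, branches, ih₁, ih₂, graph_restrict, Function.comp_def]

theorem branches_ne_nil (T : JoinTree) : ∃ b, b ∈ T.branches := by
  induction T with
  | leaf G => exact ⟨[G], by simp [branches]⟩
  | node T₁ T₂ ih₁ ih₂ =>
    obtain ⟨b, hb⟩ := ih₁
    exact ⟨T₂.graph :: b, by simp [branches, hb]⟩

theorem mem_branches_node {T₁ T₂ : JoinTree} {b : List PGraph} :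
    b ∈ (node T₁ T₂).branches ↔ (∃ b' ∈ T₁.branches, b = T₂.graph :: b') ∨
      ∃ b' ∈ T₂.branches, b = T₁.graph :: b' := by
  simp [branches, eq_comm]

theorem unionL_eq_graph {T : JoinTree} {b : List PGraph} (hb : b ∈ T.branches) :
    unionL b = T.graph := by
  induction T generalizing b with
  | leaf G =>
    obtain rfl : b = [G] := by simpa [branches] using hb
    simp [unionL, graph]
  | node T₁ T₂ ih₁ ih₂ =>
    rcases mem_branches_node.1 hb with ⟨b', hb', rfl⟩ | ⟨b', hb', rfl⟩
    · rw [unionL, ih₁ hb', graph, Finset.union_comm]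
    · rw [unionL, ih₂ hb', graph]

theorem subset_graph {T : JoinTree} {b : List PGraph} (hb : b ∈ T.branches) {C : PGraph}
    (hC : C ∈ b) : C ⊆ T.graph :=
  unionL_eq_graph hb ▸ subset_unionL hC

end JoinTree

theorem List.exists_map_eq_of_subset_map {α β : Type*} {f : α → β} {l : List α} {l' : List β}
    (h : l' ⊆ l.map f) : ∃ l'' ⊆ l, l''.map f = l' := by
  induction l' with
  | nil => exact ⟨[], by simp, rfl⟩
  | cons a l' ih =>
    rw [List.cons_subset] at h
    obtain ⟨l'', h1, rfl⟩ := ih h.2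
    obtain ⟨x, hx, rfl⟩ := List.mem_map.1 h.1
    exact ⟨x :: l'', List.cons_subset.2 ⟨hx, h1⟩, rfl⟩

/-- A list of branch labels of the restriction to a union of components of the root graph lifts
to a list of branch labels covering the root graph. -/
theorem exists_branch_lift {T : JoinTree} {H : PGraph} (hH : IsSaturated T.graph H)
    {b' L' : List PGraph} (hb' : b' ∈ (T.restrict H).branches) (hL' : L' ⊆ b') :
    ∃ b ∈ T.branches, ∃ M ⊆ b, unionL M = T.graph ∧ dvec L' + Delta (T.graph \ H) ≤ dvec M := by
  rw [JoinTree.branches_restrict, List.mem_map] at hb'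
  obtain ⟨b, hb, rfl⟩ := hb'
  obtain ⟨L, hL, rfl⟩ := List.exists_map_eq_of_subset_map hL'
  have hsub : ∀ C ∈ L ++ b, C ⊆ T.graph := fun C hC =>
    JoinTree.subset_graph hb ((List.mem_append.1 hC).elim (fun h => hL h) id)
  refine ⟨b, hb, L ++ b, List.append_subset.2 ⟨hL, List.Subset.refl _⟩, ?_, ?_⟩
  · rw [unionL_append, JoinTree.unionL_eq_graph hb, Finset.union_eq_right]
    exact unionL_subset fun C hC => hsub C (List.mem_append_left _ hC)
  · have h := hH.dvecFrom_inter_add_le hsub (Finset.empty_subset _)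
    simp only [Finset.empty_inter, List.map_append] at h
    change dvec _ + dvec _ ≤ dvec _ at h
    rw [dvec_append, dvec_append] at h
    have h1 := Delta_unionL_le (b.map (· ∩ (T.graph \ H)))
    have h2 : unionL (b.map (· ∩ (T.graph \ H))) = T.graph \ H := by
      have := JoinTree.unionL_eq_graph (T := T.restrict (T.graph \ H))
        (b := b.map (· ∩ (T.graph \ H)))
        (by rw [JoinTree.branches_restrict]; exact List.mem_map_of_mem hb)
      rw [this, JoinTree.graph_restrict, Finset.inter_eq_right]
      exact Finset.sdiff_subset
    rw [h2] at h1
    have h3 := Delta_union_unionL_le (unionL (L.map (· ∩ (T.graph \ H))))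
      (b.map (· ∩ (T.graph \ H)))
    have h4 := Delta_unionL_le (L.map (· ∩ (T.graph \ H)))
    have h5 : unionL (L.map (· ∩ (T.graph \ H))) ∪ (T.graph \ H) = T.graph \ H := by
      rw [Finset.union_eq_right]
      refine unionL_subset fun C hC => ?_
      obtain ⟨D, -, rfl⟩ := List.mem_map.1 hC
      exact Finset.inter_subset_right
    rw [h2, h5] at h3
    omega

theorem graph_sqComb (m : ℕ) (T : Fin (m + 1) → JoinTree) :
    (sqComb m T).graph = Finset.univ.biUnion fun i => (T i).graph := by
  induction m with
  | zero => ext; simp [sqComb]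
  | succ m ih => ext; simp [sqComb, JoinTree.graph, ih, Fin.exists_fin_succ]

theorem valid_sqComb {m : ℕ} {T : Fin (m + 1) → JoinTree} (h : (sqComb m T).valid) (i) :
    (T i).valid := by
  induction m with
  | zero => rwa [Fin.fin_one_eq_zero i]
  | succ m ih =>
    cases i using Fin.cases with
    | zero => exact h.1
    | succ i => exact ih h.2 i

theorem restrict_sqComb (H : PGraph) (m : ℕ) (T : Fin (m + 1) → JoinTree) :
    (sqComb m T).restrict H = sqComb m fun i => (T i).restrict H := by
  induction m with
  | zero => rfl
  | succ m ih => simp [sqComb, JoinTree.restrict, ih]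

theorem SqDepthLE.restrict {d : ℕ} {T : JoinTree} (h : SqDepthLE d T) (H : PGraph) :
    SqDepthLE d (T.restrict H) := by
  induction h with
  | base d G => exact .base d _
  | step d m T _ ih => rw [restrict_sqComb]; exact .step d m _ ih

theorem exists_branch_sqComb {m : ℕ} (T : Fin (m + 1) → JoinTree) (j : Fin (m + 1))
    {b : List PGraph} (hb : b ∈ (T j).branches) :
    ∃ b' ∈ (sqComb m T).branches, b ⊆ b' ∧ ∀ i < j, (T i).graph ∈ b' := by
  induction m with
  | zero =>
    obtain rfl := Fin.fin_one_eq_zero j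
    exact ⟨b, hb, List.Subset.refl _, fun i hi => absurd hi (by simp)⟩
  | succ m ih =>
    cases j using Fin.cases with
    | zero =>
      exact ⟨_ :: b, JoinTree.mem_branches_node.2 (Or.inl ⟨b, hb, rfl⟩), List.subset_cons_self _ _,
        fun i hi => absurd hi (by simp)⟩
    | succ j =>
      obtain ⟨b', hb', hbb, hi⟩ := ih (fun i => T i.succ) j hb
      refine ⟨_ :: b', JoinTree.mem_branches_node.2 (Or.inr ⟨b', hb', rfl⟩),
        List.subset_cons_of_subset _ hbb, fun i hij => ?_⟩
      cases i using Fin.cases with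
      | zero => exact List.mem_cons_self
      | succ i => exact List.mem_cons_of_mem _ (hi i (by simpa using hij))

theorem valid_semComb {m : ℕ} {T : Fin (m + 1) → JoinTree} (h : (semComb m T).valid) (i) :
    (T i).valid := by
  induction m with
  | zero => rwa [Fin.fin_one_eq_zero i]
  | succ m ih =>
    cases i using Fin.lastCases with
    | last => simpa using ih h.2 (Fin.last m)
    | cast i => exact ih h.1 i

theorem restrict_semComb (H : PGraph) (m : ℕ) (T : Fin (m + 1) → JoinTree) :
    (semComb m T).restrict H = semComb m fun i => (T i).restrict H := by
  induction m with
  | zero => rfl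
  | succ m ih => simp [semComb, JoinTree.restrict, ih, apply_ite (JoinTree.restrict H)]

theorem SemDepthLE.restrict {d : ℕ} {T : JoinTree} (h : SemDepthLE d T) (H : PGraph) :
    SemDepthLE d (T.restrict H) := by
  induction h with
  | base d G => exact .base d _
  | step d m T _ ih => rw [restrict_semComb]; exact .step d m _ ih

/-- `⟦t 0, …, t m⟧` for a sequence of join trees. -/
def semSeq : ℕ → (ℕ → JoinTree) → JoinTree
  | 0, t => t 0
  | m + 1, t => .node (semSeq m t) (semSeq m (Function.update t m (t (m + 1))))

theorem semComb_eq_semSeq {m : ℕ} {T : Fin (m + 1) → JoinTree} {t : ℕ → JoinTree}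
    (h : ∀ i : Fin (m + 1), t i = T i) : semComb m T = semSeq m t := by
  induction m generalizing t with
  | zero => exact (h 0).symm
  | succ m ih =>
    rw [semComb, semSeq, ih (t := t) fun i => by simpa using h i.castSucc,
      ih (t := Function.update t m (t (m + 1)))]
    intro i
    by_cases hi : (i : ℕ) = m
    · have := h (Fin.last (m + 1))
      simp only [Fin.val_last] at this
      simp [hi, this]
    · have := h i.castSucc
      simpa [hi, Function.update_of_ne] using this

theorem semSeq_congr {m : ℕ} {t t' : ℕ → JoinTree} (h : ∀ i ≤ m, t i = t' i) :
    semSeq m t = semSeq m t' := by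
  induction m generalizing t t' with
  | zero => exact h 0 le_rfl
  | succ m ih =>
    rw [semSeq, semSeq, ih fun i hi => h i (by omega)]
    congr 1
    refine ih fun i hi => ?_
    by_cases him : i = m
    · simp [him, h (m + 1) le_rfl]
    · simp [him, h i (by omega)]

/-- The union of the root graphs of the first `x` trees of a sequence. -/
def graphBelow (t : ℕ → JoinTree) (x : ℕ) : PGraph := (Finset.range x).biUnion fun l => (t l).graph

theorem mem_graphBelow {t : ℕ → JoinTree} {x : ℕ} {e : ℤ} :
    e ∈ graphBelow t x ↔ ∃ l < x, e ∈ (t l).graph := by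
  simp [graphBelow]

theorem graphBelow_mono {t : ℕ → JoinTree} {x y : ℕ} (h : x ≤ y) :
    graphBelow t x ⊆ graphBelow t y :=
  Finset.biUnion_subset_biUnion_of_subset_left _ (Finset.range_mono h)

theorem graphBelow_succ (t : ℕ → JoinTree) (x : ℕ) :
    graphBelow t (x + 1) = (t x).graph ∪ graphBelow t x := by
  rw [graphBelow, Finset.range_add_one, Finset.biUnion_insert, graphBelow]

theorem graphBelow_congr {x : ℕ} {t t' : ℕ → JoinTree} (h : ∀ i < x, t i = t' i) :
    graphBelow t x = graphBelow t' x :=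
  Finset.biUnion_congr rfl fun i hi => by rw [h i (Finset.mem_range.1 hi)]

theorem graphBelow_update (t : ℕ → JoinTree) (x : ℕ) (T : JoinTree) :
    graphBelow (Function.update t x T) x = graphBelow t x :=
  graphBelow_congr fun _ hi => Function.update_of_ne hi.ne _ _

theorem graph_semSeq (m : ℕ) (t : ℕ → JoinTree) : (semSeq m t).graph = graphBelow t (m + 1) := by
  induction m generalizing t with
  | zero => simp [semSeq, graphBelow]
  | succ m ih =>
    rw [semSeq, JoinTree.graph, ih, ih, graphBelow_succ t (m + 1),
      graphBelow_succ _ m, graphBelow_succ _ m, graphBelow_update, Function.update_self]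
    ext
    simp only [Finset.mem_union]
    tauto

theorem exists_branch_semSeq_update {i m : ℕ} (him : i ≤ m) (t : ℕ → JoinTree) {b : List PGraph}
    (hb : b ∈ (semSeq i (Function.update t i (t m))).branches) :
    ∃ b' ∈ (semSeq m t).branches, b ⊆ b' := by
  induction m, him using Nat.le_induction generalizing t with
  | base => exact ⟨b, by simpa using hb, List.Subset.refl _⟩
  | succ m him ih =>
    obtain ⟨b', hb', hbb⟩ := ih (Function.update t m (t (m + 1))) (by
      convert hb using 2
      refine semSeq_congr fun l hl => ?_
      by_cases hli : l = i
      · simp [hli]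
      · simp [hli, Function.update_of_ne (show l ≠ m by omega)])
    exact ⟨_ :: b', JoinTree.mem_branches_node.2 (Or.inr ⟨b', hb', rfl⟩),
      List.subset_cons_of_subset _ hbb⟩

theorem exists_branch_semSeq_lt {x y : ℕ} (hxy : x < y) (t : ℕ → JoinTree) {b : List PGraph}
    (hb : b ∈ (semSeq x t).branches) :
    ∃ b' ∈ (semSeq y t).branches, b ⊆ b' ∧ (t y).graph ∪ graphBelow t x ∈ b' := by
  set t' := Function.update t (x + 1) (t y) with ht'
  have h1 : semSeq x t' = semSeq x t := semSeq_congr fun i hi => by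
    rw [ht', Function.update_of_ne (by omega)]
  have h2 : (semSeq x (Function.update t' x (t' (x + 1)))).graph =
      (t y).graph ∪ graphBelow t x := by
    rw [graph_semSeq, graphBelow_succ, graphBelow_update, Function.update_self, ht',
      Function.update_self, graphBelow_congr fun _ _ => Function.update_of_ne (by omega) _ _]
  obtain ⟨b', hb', hbb⟩ := exists_branch_semSeq_update (Nat.succ_le_of_lt hxy) t
    (b := ((t y).graph ∪ graphBelow t x) :: b)
    (JoinTree.mem_branches_node.2 (Or.inl ⟨b, by rw [h1]; exact hb, by rw [h2]⟩))
  rw [List.cons_subset] at hbb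
  exact ⟨b', hb', hbb.2, hbb.1⟩

theorem exists_branch_semSeq_le {x y : ℕ} (hxy : x ≤ y) (t : ℕ → JoinTree) {b : List PGraph}
    (hb : b ∈ (semSeq x t).branches) : ∃ b' ∈ (semSeq y t).branches, b ⊆ b' := by
  rcases hxy.eq_or_lt with rfl | h
  · exact ⟨b, hb, List.Subset.refl _⟩
  · obtain ⟨b', hb', hbb, -⟩ := exists_branch_semSeq_lt h t hb
    exact ⟨b', hb', hbb⟩

theorem exists_branch_semSeq_self (x : ℕ) (t : ℕ → JoinTree) {b : List PGraph}
    (hb : b ∈ (t x).branches) :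
    ∃ b' ∈ (semSeq x t).branches, b ⊆ b' ∧ (x = 0 ∨ graphBelow t x ∈ b') := by
  cases x with
  | zero => exact ⟨b, hb, List.Subset.refl _, Or.inl rfl⟩
  | succ x =>
    obtain ⟨b', hb', hbb⟩ := exists_branch_semSeq_update (Nat.zero_le x)
      (Function.update t x (t (x + 1))) (b := b) (by simpa [semSeq] using hb)
    refine ⟨_ :: b', JoinTree.mem_branches_node.2 (Or.inr ⟨b', hb', rfl⟩),
      List.subset_cons_of_subset _ hbb, Or.inr ?_⟩
    rw [graph_semSeq]
    exact List.mem_cons_self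

/-- Every list of labels along a branch of `T` has `Δ⃗` at most `S`. -/
def BranchBound (T : JoinTree) (S : ℕ) : Prop :=
  ∀ b ∈ T.branches, ∀ L ⊆ b, dvec L ≤ S

theorem exists_chain_of_card_antichain_le {α : Type*} {R : α → α → Prop} {A : ℕ} {E : Finset α}
    (hA : ∀ B ⊆ E, (∀ x ∈ B, ∀ y ∈ B, ¬ R x y) → B.card ≤ A) (r : ℕ) (hr : r * A < E.card) :
    ∃ e l, List.IsChain R (e :: l) ∧ l.length = r ∧ ∀ x ∈ e :: l, x ∈ E := by
  induction r generalizing E with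
  | zero =>
    obtain ⟨e, he⟩ := Finset.card_pos.1 (by omega : 0 < E.card)
    exact ⟨e, [], by simp, rfl, by simpa using he⟩
  | succ r ih =>
    set B := E.filter fun y => ∀ x ∈ E, ¬ R x y with hB
    have hBE : B ⊆ E := Finset.filter_subset _ _
    have hBA := hA B hBE fun x hx y hy => (Finset.mem_filter.1 hy).2 x (hBE hx)
    have hcard := Finset.card_sdiff_add_card_eq_card hBE
    obtain ⟨e, l, hl, hlen, hmem⟩ := ih (E := E \ B)
      (fun C hC => hA C (hC.trans Finset.sdiff_subset)) (by rw [add_one_mul] at hr; omega)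
    have he := Finset.mem_sdiff.1 (hmem e List.mem_cons_self)
    obtain ⟨x, hx, hxe⟩ : ∃ x ∈ E, R x e := by
      by_contra! h
      exact he.2 (Finset.mem_filter.2 ⟨he.1, h⟩)
    refine ⟨x, e :: l, List.isChain_cons_cons.2 ⟨hxe, hl⟩, by simp [hlen], fun y hy => ?_⟩
    rcases List.mem_cons.1 hy with rfl | hy
    · exact hx
    · exact (Finset.mem_sdiff.1 (hmem y hy)).1

/-- The index of the first tree of the sequence whose root graph contains `e`. -/
def birth (t : ℕ → JoinTree) (e : ℤ) : ℕ := sInf {l | e ∈ (t l).graph}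

/-- The size of the component of `e` in the first root graph containing it. -/
def birthSize (t : ℕ → JoinTree) (e : ℤ) : ℕ := (comp (t (birth t e)).graph e).card

theorem notMem_graphBelow_birth (t : ℕ → JoinTree) (e : ℤ) : e ∉ graphBelow t (birth t e) := by
  intro h
  obtain ⟨l, hl, he⟩ := mem_graphBelow.1 h
  exact Nat.notMem_of_lt_sInf hl he

theorem birth_spec {t : ℕ → JoinTree} {x : ℕ} {e : ℤ} (h : e ∈ graphBelow t x) :
    birth t e < x ∧ e ∈ (t (birth t e)).graph := by
  obtain ⟨l, hl, he⟩ := mem_graphBelow.1 h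
  exact ⟨(Nat.sInf_le he).trans_lt hl, Nat.sInf_mem (s := {l | e ∈ (t l).graph}) ⟨l, he⟩⟩

theorem lt_birth_of_notMem {t : ℕ → JoinTree} {j : ℕ} {e : ℤ} (h : j < birth t e) :
    e ∉ graphBelow t (j + 1) := fun he =>
  notMem_graphBelow_birth t e (graphBelow_mono h he)

/-- `e'` is born after `e`, away from everything present when `e` is born. -/
def BornAfter (t : ℕ → JoinTree) (e e' : ℤ) : Prop :=
  birth t e < birth t e' ∧ ∀ j ∈ comp (t (birth t e')).graph e',
    ∀ f ∈ graphBelow t (birth t e + 1), 1 < (j - f).natAbs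

theorem BornAfter.Delta_ominus_pos {t : ℕ → JoinTree} {e e' : ℤ} (h : BornAfter t e e')
    (he' : e' ∈ (t (birth t e')).graph) {F : PGraph} (hF : F ⊆ graphBelow t (birth t e + 1)) :
    1 ≤ Delta (ominus ((t (birth t e')).graph ∪ graphBelow t (birth t e)) F) := by
  set G := (t (birth t e')).graph
  set U := graphBelow t (birth t e)
  have hsat : IsSaturated (G ∪ U) (comp G e') := by
    refine ⟨(comp_subset _ _).trans Finset.subset_union_left, fun a ha b hb hab => ?_⟩
    rcases Finset.mem_union.1 hb with hb | hb
    · refine comp_trans ha (mem_comp.2 fun l h1 h2 => ?_)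
      obtain rfl | rfl : l = a ∨ l = b := by omega
      exacts [comp_subset _ _ ha, hb]
    · have := h.2 a ha b (graphBelow_mono (by omega) hb)
      omega
  refine Delta_pos ⟨e', mem_ominus.2 ⟨Finset.mem_union_left _ he', fun j hj f hf => ?_⟩⟩
  exact h.2 j (hsat.mem_of_mem_comp (Finset.Subset.refl _) (self_mem_comp he') hj) f (hF hf)

theorem length_add_le_of_isChain_bornAfter {m S : ℕ} {t : ℕ → JoinTree}
    (hS : BranchBound (semSeq m t) S) {e : ℤ} {l : List ℤ} (hl : List.IsChain (BornAfter t) (e :: l))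
    (hmem : ∀ x ∈ e :: l, x ∈ graphBelow t (m + 1)) {b M : List PGraph}
    (hb : b ∈ (semSeq (birth t e) t).branches) (hM : M ⊆ b)
    (hMU : unionL M ⊆ graphBelow t (birth t e + 1)) : dvec M + l.length ≤ S := by
  induction l generalizing e b M with
  | nil =>
    obtain ⟨b', hb', hbb⟩ := exists_branch_semSeq_le
      (Nat.lt_succ_iff.1 (birth_spec (hmem e (by simp))).1) t hb
    simpa using hS b' hb' M fun x hx => hbb (hM hx)
  | cons e' l ih =>
    obtain ⟨hR, hl⟩ := List.isChain_cons_cons.1 hl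
    have he' := (birth_spec (hmem e' (by simp))).2
    obtain ⟨b', hb', hbb, hstep⟩ := exists_branch_semSeq_lt hR.1 t hb
    have hpos := hR.Delta_ominus_pos he' hMU
    have := ih hl (fun x hx => hmem x (List.mem_cons_of_mem _ hx)) hb'
      (M := M ++ [(t (birth t e')).graph ∪ graphBelow t (birth t e)])
      (List.append_subset.2 ⟨fun x hx => hbb (hM hx), by simpa using hstep⟩) (by
        rw [unionL_append, graphBelow_succ]
        simp only [unionL, Finset.union_empty]
        have h1 : graphBelow t (birth t e + 1) ⊆ graphBelow t (birth t e') :=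
          graphBelow_mono hR.1
        have h2 : graphBelow t (birth t e) ⊆ graphBelow t (birth t e') :=
          graphBelow_mono hR.1.le
        exact Finset.union_subset ((hMU.trans h1).trans Finset.subset_union_right)
          (Finset.union_subset_union_right h2))
    rw [dvec_append] at this
    simp only [dvecFrom] at this
    simp only [List.length_cons]
    omega

/-- Few edges of `⟦t 0, …, t m⟧` are born in components of size about `W`. -/
theorem card_birthSize_le {m S β W : ℕ} {t : ℕ → JoinTree} (hS : BranchBound (semSeq m t) S)
    (hβ : ∀ j ≤ m, ∀ H ⊆ (t j).graph, W ≤ H.card →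
      ∃ b ∈ ((t j).restrict H).branches, ∃ L ⊆ b, β ≤ dvec L)
    {E : PGraph} (hE : E.Nonempty)
    (hEW : ∀ e ∈ E, e ∈ graphBelow t (m + 1) ∧ W ≤ birthSize t e ∧ birthSize t e < 3 * W) :
    ∃ n, n + β = S + 1 ∧ E.card ≤ 9 * W * n ^ 2 := by
  have base : ∀ e ∈ E, ∃ b ∈ (t (birth t e)).branches, ∃ M ⊆ b, unionL M = (t (birth t e)).graph ∧
      β + Delta (t (birth t e)).graph ≤ dvec M + 1 := by
    intro e he
    obtain ⟨heU, heW, -⟩ := hEW e he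
    obtain ⟨hlt, heG⟩ := birth_spec heU
    obtain ⟨H, hH, hcard, hΔ⟩ := exists_saturated_comp heG
    obtain ⟨b', hb', L', hL', hβL⟩ := hβ _ (Nat.lt_succ_iff.1 hlt) H hH.1 (heW.trans hcard)
    obtain ⟨b, hb, M, hM, hMG, hd⟩ := exists_branch_lift hH hb' hL'
    exact ⟨b, hb, M, hM, hMG, by omega⟩
  have chain : ∀ e l, List.IsChain (BornAfter t) (e :: l) → (∀ x ∈ e :: l, x ∈ E) →
      β + l.length ≤ S := by
    intro e l hl hmem
    obtain ⟨b, hb, M, hM, hMG, hd⟩ := base e (hmem e (by simp))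
    obtain ⟨b', hb', hbb, -⟩ := exists_branch_semSeq_self (birth t e) t hb
    have := length_add_le_of_isChain_bornAfter hS hl (fun x hx => (hEW x (hmem x hx)).1) hb'
      (fun x hx => hbb (hM hx)) (by rw [hMG, graphBelow_succ]; exact Finset.subset_union_left)
    have := Delta_pos ⟨e, (birth_spec (hEW e (hmem e (by simp))).1).2⟩
    omega
  have hβS : β ≤ S := by
    obtain ⟨e, he⟩ := hE
    have := chain e [] (by simp) (by simpa using he)
    simpa using this
  refine ⟨S + 1 - β, by omega, ?_⟩
  set n := S + 1 - β with hn
  have anti : ∀ B ⊆ E, (∀ x ∈ B, ∀ y ∈ B, ¬ BornAfter t x y) → B.card ≤ 9 * W * n := by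
    intro B hBE hB
    rcases B.eq_empty_or_nonempty with rfl | hne
    · simp
    obtain ⟨e, heB, hmin⟩ := Finset.exists_min_image B (birth t) hne
    obtain ⟨b, hb, M, hM, hMG, hd⟩ := base e (hBE heB)
    have hej := Nat.lt_succ_iff.1 (birth_spec (hEW e (hBE heB)).1).1
    obtain ⟨b₁, hb₁, hbb₁, hU⟩ := exists_branch_semSeq_self (birth t e) t hb
    obtain ⟨b', hb', hbb⟩ := exists_branch_semSeq_le hej t hb₁
    set G := (t (birth t e)).graph
    have h1 : Delta G ≤ n := by
      have := hS b' hb' M fun x hx => hbb (hbb₁ (hM hx))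
      omega
    have h2 : Delta (graphBelow t (birth t e + 1)) ≤ n := by
      rw [graphBelow_succ]
      change Delta (G ∪ _) ≤ n
      rcases hU with h0 | hU
      · simpa [graphBelow, h0] using h1
      · have := hS b' hb' (M ++ [graphBelow t (birth t e)]) (List.append_subset.2
          ⟨fun x hx => hbb (hbb₁ (hM hx)), by simpa using hbb hU⟩)
        rw [dvec_append, hMG] at this
        simp only [dvecFrom] at this
        have := Delta_union_le G (graphBelow t (birth t e))
        omega
    have hsub : B ⊆ (G.filter fun x => (comp G x).card < 3 * W) ∪
        B.filter fun x => birth t e < birth t x := by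
      intro x hx
      rw [Finset.mem_union, Finset.mem_filter, Finset.mem_filter]
      rcases (hmin x hx).eq_or_lt with h | h
      · left
        obtain ⟨hxU, -, hxW⟩ := hEW x (hBE hx)
        rw [birthSize, ← h] at hxW
        have := (birth_spec hxU).2
        rw [← h] at this
        exact ⟨this, hxW⟩
      · exact Or.inr ⟨hx, h⟩
    have h3 := card_filter_comp_lt_le G (3 * W)
    have h4 : (B.filter fun x => birth t e < birth t x).card ≤
        2 * (3 * W) * Delta (graphBelow t (birth t e + 1)) := by
      refine card_le_of_near fun x hx => ?_
      obtain ⟨hxB, hlt⟩ := Finset.mem_filter.1 hx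
      refine ⟨lt_birth_of_notMem hlt, (t (birth t x)).graph, (hEW x (hBE hxB)).2.2.le, ?_⟩
      by_contra! h
      exact hB e heB x hxB ⟨hlt, fun j hj f hf => h j hj f hf⟩
    have h5 := (Finset.card_le_card hsub).trans (Finset.card_union_le _ _)
    have h6 := Nat.mul_le_mul_left (3 * W) h1
    have h7 := Nat.mul_le_mul_left (2 * (3 * W)) h2
    calc B.card ≤ 3 * W * n + 2 * (3 * W) * n := by omega
      _ = 9 * W * n := by ring
  by_contra! hlt
  obtain ⟨e, l, hl, hlen, hmem⟩ := exists_chain_of_card_antichain_le anti n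
    (lt_of_eq_of_lt (by ring) hlt)
  have := chain e l hl hmem
  omega

theorem exists_greedy_cover (𝓕 : List PGraph) (F : PGraph) :
    ∃ X ⊆ 𝓕, X.length ≤ dvecFrom F X ∧ ∀ G ∈ 𝓕, ominus G (F ∪ unionL X) = ∅ := by
  induction 𝓕 generalizing F with
  | nil => exact ⟨[], List.Subset.refl _, le_rfl, by simp⟩
  | cons G 𝓕 ih =>
    by_cases hG : ominus G F = ∅
    · obtain ⟨X, hX, hlen, hcov⟩ := ih F
      refine ⟨X, List.subset_cons_of_subset _ hX, hlen, fun C hC => ?_⟩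
      rcases List.mem_cons.1 hC with rfl | hC
      · exact Finset.subset_empty.1 (hG ▸ ominus_anti Finset.subset_union_left)
      · exact hcov C hC
    · obtain ⟨X, hX, hlen, hcov⟩ := ih (F ∪ G)
      have := Delta_pos (Finset.nonempty_iff_ne_empty.2 hG)
      refine ⟨G :: X, List.cons_subset_cons _ hX, by simp only [List.length_cons, dvecFrom]; omega,
        fun C hC => ?_⟩
      rw [unionL, ← Finset.union_assoc]
      rcases List.mem_cons.1 hC with rfl | hC
      · exact ominus_eq_empty (Finset.subset_union_right.trans Finset.subset_union_left)
      · exact hcov C hC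

theorem card_inter_unionL_le {E : PGraph} {X : List PGraph} {M : ℕ}
    (h : ∀ C ∈ X, (E ∩ C).card ≤ M) : (E ∩ unionL X).card ≤ M * X.length := by
  induction X with
  | nil => simp [unionL]
  | cons C X ih =>
    have h1 := ih fun D hD => h D (by simp [hD])
    have h2 := h C (by simp)
    have h3 := Finset.card_union_le (E ∩ C) (E ∩ unionL X)
    rw [unionL, Finset.inter_union_distrib_left, List.length_cons, mul_add_one]
    omega

/-- The size of the largest root graph of the trees `T i` that contains `e`. -/
def maxSize {m : ℕ} (T : Fin (m + 1) → JoinTree) (e : ℤ) : ℕ :=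
  Finset.univ.sup fun i => if e ∈ (T i).graph then (T i).graph.card else 0

theorem card_le_maxSize {m : ℕ} {T : Fin (m + 1) → JoinTree} {e : ℤ} {i : Fin (m + 1)}
    (h : e ∈ (T i).graph) : (T i).graph.card ≤ maxSize T e := by
  have := Finset.le_sup (f := fun i => if e ∈ (T i).graph then (T i).graph.card else 0)
    (Finset.mem_univ i)
  simp only [if_pos h] at this
  exact this

theorem exists_card_eq_maxSize {m : ℕ} {T : Fin (m + 1) → JoinTree} {e : ℤ}
    (h : 0 < maxSize T e) : ∃ i, e ∈ (T i).graph ∧ (T i).graph.card = maxSize T e := by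
  obtain ⟨i, -, hi⟩ := Finset.exists_mem_eq_sup Finset.univ ⟨0, Finset.mem_univ _⟩
    fun i => if e ∈ (T i).graph then (T i).graph.card else 0
  change maxSize T e = _ at hi
  by_cases he : e ∈ (T i).graph
  · exact ⟨i, he, by rw [hi, if_pos he]⟩
  · rw [if_neg he] at hi
    omega

/-- Few edges of `[T 0, …, T m]` have `maxSize` about `W`. -/
theorem card_maxSize_le {m S β W : ℕ} {T : Fin (m + 1) → JoinTree} (hW : 1 ≤ W)
    (hS : BranchBound (sqComb m T) S)
    (hβ : ∀ j, ∀ H ⊆ (T j).graph, W ≤ 2 * H.card →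
      ∃ b ∈ ((T j).restrict H).branches, ∃ L ⊆ b, β ≤ dvec L)
    {E : PGraph} (hE : E.Nonempty) (hEW : ∀ e ∈ E, W ≤ maxSize T e ∧ maxSize T e < 3 * W) :
    ∃ n, n + β = S + 1 ∧ E.card ≤ 12 * W * n := by
  have hJ : (Finset.univ.filter fun j => W ≤ (T j).graph.card).Nonempty := by
    obtain ⟨e, he⟩ := hE
    obtain ⟨i, -, hi⟩ := exists_card_eq_maxSize (hW.trans (hEW e he).1)
    exact ⟨i, by simpa [hi] using (hEW e he).1⟩
  obtain ⟨j, hj, hmax⟩ := Finset.exists_max_image _ id hJ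
  simp only [Finset.mem_filter, Finset.mem_univ, true_and, id] at hj hmax
  obtain ⟨H, hH, hcard, hΔ⟩ := exists_saturated_half (T j).graph
  obtain ⟨b', hb', L', hL', hβL⟩ := hβ j H hH.1 (hj.trans hcard)
  obtain ⟨b, hb, M, hM, hMG, hd⟩ := exists_branch_lift hH hb' hL'
  obtain ⟨b₁, hb₁, hbb, hlt⟩ := exists_branch_sqComb T j hb
  set 𝓕 := ((Finset.univ.filter fun i => i < j ∧ W ≤ (T i).graph.card).toList).map
    fun i => (T i).graph with h𝓕
  have hmem𝓕 : ∀ C, C ∈ 𝓕 ↔ ∃ i, (i < j ∧ W ≤ (T i).graph.card) ∧ (T i).graph = C := by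
    simp [h𝓕]
  obtain ⟨X, hX, hlen, hcov⟩ := exists_greedy_cover 𝓕 (T j).graph
  have hSb := hS b₁ hb₁ (M ++ X) (List.append_subset.2 ⟨fun x hx => hbb (hM hx), fun C hC => by
    obtain ⟨i, hi, rfl⟩ := (hmem𝓕 C).1 (hX hC)
    exact hlt i hi.1⟩)
  rw [dvec_append, hMG] at hSb
  set F := (T j).graph ∪ unionL X with hF
  have hsmall : ∀ i, (E ∩ (T i).graph).card ≤ 3 * W := by
    intro i
    rcases (E ∩ (T i).graph).eq_empty_or_nonempty with h | ⟨e, he⟩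
    · simp [h]
    · rw [Finset.mem_inter] at he
      have h1 := card_le_maxSize he.2
      have h2 := (hEW e he.1).2
      exact (Finset.card_le_card Finset.inter_subset_right).trans (by omega)
  have h1 : (E ∩ F).card ≤ 3 * W * (X.length + 1) := by
    have := card_inter_unionL_le (E := E) (X := (T j).graph :: X) (M := 3 * W) fun C hC => by
      rcases List.mem_cons.1 hC with rfl | hC
      · exact hsmall j
      · obtain ⟨i, -, rfl⟩ := (hmem𝓕 C).1 (hX hC)
        exact hsmall i
    simpa [unionL, hF] using this
  have h2 : (E \ F).card ≤ 2 * (3 * W) * Delta F := by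
    refine card_le_of_near fun e he => ?_
    obtain ⟨heE, heF⟩ := Finset.mem_sdiff.1 he
    obtain ⟨hw1, hw2⟩ := hEW e heE
    obtain ⟨i, hei, hi⟩ := exists_card_eq_maxSize (hW.trans hw1)
    refine ⟨heF, (T i).graph, (Finset.card_le_card (comp_subset _ _)).trans (by omega), ?_⟩
    have hij : i < j := by
      refine lt_of_le_of_ne (hmax i (by omega)) ?_
      rintro rfl
      exact heF (Finset.mem_union_left _ hei)
    have hemp := hcov _ ((hmem𝓕 _).2 ⟨i, ⟨hij, by omega⟩, rfl⟩)
    by_contra! h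
    exact Finset.notMem_empty e (hemp ▸ mem_ominus.2 ⟨hei, fun y hy f hf => h y hy f hf⟩)
  have h3 : Delta F ≤ Delta (T j).graph + dvecFrom (T j).graph X := Delta_union_unionL_le _ _
  have h4 : E.card = (E ∩ F).card + (E \ F).card := (Finset.card_inter_add_card_sdiff E F).symm
  obtain ⟨n, hn⟩ : ∃ n, n + β = S + 1 := ⟨S + 1 - β, by omega⟩
  refine ⟨n, hn, ?_⟩
  have h5 : 3 * W * (X.length + 1) ≤ 3 * W * (dvecFrom (T j).graph X + 1) := by gcongr
  have h6 : 2 * (3 * W) * Delta F ≤ 2 * (3 * W) *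
      (2 * Delta ((T j).graph \ H) + 1 + dvecFrom (T j).graph X) := by
    gcongr
    omega
  have h7 : Delta ((T j).graph \ H) + dvecFrom (T j).graph X + 1 ≤ n := by omega
  have h8 := Nat.mul_le_mul_left (12 * W) h7
  nlinarith [Nat.zero_le (W * dvecFrom (T j).graph X)]

theorem five_sixths_le_sum_Ioc_inv {q : ℕ} (hq : 1 ≤ q) :
    (5 / 6 : ℝ) ≤ ∑ W ∈ Finset.Ioc q (3 * q), (W : ℝ)⁻¹ := by
  induction q, hq using Nat.le_induction with
  | base =>
    rw [show Finset.Ioc 1 (3 * 1) = {2, 3} by decide]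
    norm_num
  | succ q hq ih =>
    have h1 : ∑ W ∈ Finset.Ioc q (3 * (q + 1)), (W : ℝ)⁻¹ =
        ((q + 1 : ℕ) : ℝ)⁻¹ + ∑ W ∈ Finset.Ioc (q + 1) (3 * (q + 1)), (W : ℝ)⁻¹ := by
      rw [← Finset.sum_Ioc_consecutive _ (Nat.le_succ q) (by omega : q + 1 ≤ 3 * (q + 1))]
      simp
    have h2 : ∑ W ∈ Finset.Ioc q (3 * (q + 1)), (W : ℝ)⁻¹ =
        ∑ W ∈ Finset.Ioc q (3 * q), (W : ℝ)⁻¹ + ((3 * q + 1 : ℕ) : ℝ)⁻¹ +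
          ((3 * q + 2 : ℕ) : ℝ)⁻¹ + ((3 * q + 3 : ℕ) : ℝ)⁻¹ := by
      rw [show 3 * (q + 1) = 3 * q + 1 + 1 + 1 by ring, Finset.sum_Ioc_succ_top (by omega),
        Finset.sum_Ioc_succ_top (by omega), Finset.sum_Ioc_succ_top (by omega)]
    have h3 : ((q + 1 : ℕ) : ℝ)⁻¹ ≤ ((3 * q + 1 : ℕ) : ℝ)⁻¹ +
          ((3 * q + 2 : ℕ) : ℝ)⁻¹ + ((3 * q + 3 : ℕ) : ℝ)⁻¹ := by
      push_cast
      have hq0 : (0 : ℝ) ≤ q := Nat.cast_nonneg q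
      rw [inv_add_inv (by positivity) (by positivity), show (3 * q + 3 : ℝ) = 3 * (q + 1) by ring,
        mul_inv, ← sub_le_iff_le_add, show ((q : ℝ) + 1)⁻¹ - 3⁻¹ * ((q : ℝ) + 1)⁻¹ = 2 / (3 * (q + 1)) by
          field_simp; norm_num, div_le_div_iff₀ (by positivity) (by positivity)]
      nlinarith
    linarith

theorem five_sixths_le_sum_filter_inv {w N : ℕ} (h1 : 1 ≤ w) (hN : w ≤ N) :
    (5 / 6 : ℝ) ≤ ∑ W ∈ (Finset.Icc 1 N).filter (fun W => W ≤ w ∧ w < 3 * W), (W : ℝ)⁻¹ := by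
  rcases Nat.eq_zero_or_pos (w / 3) with h0 | hpos
  · have := Finset.single_le_sum (f := fun W : ℕ => (W : ℝ)⁻¹) (fun _ _ => by positivity)
      (show 1 ∈ (Finset.Icc 1 N).filter (fun W => W ≤ w ∧ w < 3 * W) by simp; omega)
    norm_num at this
    linarith
  · refine (five_sixths_le_sum_Ioc_inv hpos).trans
      (Finset.sum_le_sum_of_subset_of_nonneg (fun W hW => ?_) fun _ _ _ => by positivity)
    simp only [Finset.mem_Ioc, Finset.mem_filter, Finset.mem_Icc] at hW ⊢
    omega

/-- A bound on the number of elements of a finite set from bounds at each scale. -/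
theorem card_le_sum_of_scale_bound {α : Type*} (E : Finset α) (w : α → ℕ) (N : ℕ)
    (hw : ∀ e ∈ E, 1 ≤ w e ∧ w e ≤ N) (B : ℕ → ℝ)
    (hB : ∀ W ∈ Finset.Icc 1 N, ((E.filter fun e => W ≤ w e ∧ w e < 3 * W).card : ℝ) ≤ W * B W) :
    (E.card : ℝ) ≤ 6 / 5 * ∑ W ∈ Finset.Icc 1 N, B W := by
  have h1 : ∑ e ∈ E, (5 / 6 : ℝ) ≤ ∑ e ∈ E,
      ∑ W ∈ (Finset.Icc 1 N).filter (fun W => W ≤ w e ∧ w e < 3 * W), (W : ℝ)⁻¹ :=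
    Finset.sum_le_sum fun e he => five_sixths_le_sum_filter_inv (hw e he).1 (hw e he).2
  have h2 : ∑ e ∈ E, ∑ W ∈ (Finset.Icc 1 N).filter (fun W => W ≤ w e ∧ w e < 3 * W), (W : ℝ)⁻¹
      = ∑ W ∈ Finset.Icc 1 N, ((E.filter fun e => W ≤ w e ∧ w e < 3 * W).card : ℝ) * (W : ℝ)⁻¹ := by
    rw [Finset.sum_comm' (t' := Finset.Icc 1 N)
      (s' := fun W => E.filter fun e => W ≤ w e ∧ w e < 3 * W)]
    · simp
    · intro e W
      simp only [Finset.mem_filter]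
      tauto
  have h3 : ∑ W ∈ Finset.Icc 1 N, ((E.filter fun e => W ≤ w e ∧ w e < 3 * W).card : ℝ) * (W : ℝ)⁻¹
      ≤ ∑ W ∈ Finset.Icc 1 N, B W := by
    refine Finset.sum_le_sum fun W hW => ?_
    have hW0 : (0 : ℝ) < W := by
      have := (Finset.mem_Icc.1 hW).1
      exact_mod_cast this
    rw [← div_eq_mul_inv, div_le_iff₀' hW0]
    exact hB W hW
  simp only [Finset.sum_const, nsmul_eq_mul] at h1
  linarith

theorem mul_pow_mul_le_pow_add {x y : ℝ} (hx : 0 ≤ x) (hy : 0 ≤ y) (r : ℕ) :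
    (r + 1) * x ^ r * y ≤ y ^ (r + 1) + r * x ^ (r + 1) := by
  induction r with
  | zero => simp
  | succ r ih =>
    have h1 : 0 ≤ (y - x) * (y ^ (r + 1) - x ^ (r + 1)) := by
      rcases le_total x y with h | h
      · exact mul_nonneg (sub_nonneg.2 h) (sub_nonneg.2 (pow_le_pow_left₀ hx h _))
      · exact mul_nonneg_of_nonpos_of_nonpos (sub_nonpos.2 h)
          (sub_nonpos.2 (pow_le_pow_left₀ hy h _))
    have h2 := mul_le_mul_of_nonneg_left ih hx
    push_cast
    ring_nf at h1 h2 ⊢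
    linarith

theorem mul_pow_mul_sq_le_pow_add {x y : ℝ} (hx : 0 ≤ x) (hxy : x ≤ y) (q : ℕ) :
    (q + 1) * (q + 2) * x ^ q * y ^ 2 + q * (q + 1) * x ^ (q + 2) ≤
      2 * y ^ (q + 2) + 2 * q * (q + 2) * y * x ^ (q + 1) := by
  induction q with
  | zero => simp
  | succ q ih =>
    have h1 := mul_le_mul_of_nonneg_left
      (mul_pow_mul_le_pow_add hx (hx.trans hxy) (q + 1)) (sub_nonneg.2 hxy)
    have h2 := mul_le_mul_of_nonneg_left ih hx
    push_cast at h1 ⊢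
    ring_nf at h1 h2 ⊢
    linarith

/-- An upper bound for a sum of a decreasing function by the corresponding integral. -/
theorem sum_sub_le_of_pow_eq {r : ℕ} {D S : ℝ} (hS : 0 ≤ S) {y : ℕ → ℝ}
    (hy : ∀ W, 0 ≤ y W) (hpow : ∀ W, y W ^ r = D * W) (N : ℕ) :
    (r + 1) * D * ∑ W ∈ Finset.Icc 1 N, (S - y W) ≤ S ^ (r + 1) := by
  have key : (r + 1) * D * ∑ W ∈ Finset.Icc 1 N, (S - y W) ≤
      (r + 1) * y N ^ r * S - r * y N ^ (r + 1) := by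
    induction N with
    | zero =>
      have h0 : y 0 ^ r = 0 := by simpa using hpow 0
      simp [h0, pow_succ]
    | succ N ih =>
      rw [Finset.sum_Icc_succ_top (by omega), mul_add]
      have h1 := mul_pow_mul_le_pow_add (hy N) (hy (N + 1)) r
      have h2 : D = y (N + 1) ^ r - y N ^ r := by
        rw [hpow, hpow]; push_cast; ring
      have h3 : (r + 1) * D * (S - y (N + 1)) =
          (r + 1) * (y (N + 1) ^ r - y N ^ r) * (S - y (N + 1)) := by rw [← h2]
      rw [h3]
      simp only [pow_succ] at h1 ih ⊢
      linarith
  have := mul_pow_mul_le_pow_add (hy N) hS r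
  linarith

theorem sum_sub_sq_le_of_pow_eq {q : ℕ} {D S : ℝ} {y : ℕ → ℝ}
    (hy : ∀ W, 0 ≤ y W) (hmono : Monotone y) (hpow : ∀ W, y W ^ q = D * W) {N : ℕ}
    (hN : y N ≤ S) :
    (q + 1) * (q + 2) * D * ∑ W ∈ Finset.Icc 1 N, (S - y W) ^ 2 ≤ 2 * S ^ (q + 2) := by
  set P : ℝ → ℝ := fun z => (q + 1) * (q + 2) * z ^ q * S ^ 2 - 2 * q * (q + 2) * S * z ^ (q + 1)
    + q * (q + 1) * z ^ (q + 2) with hP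
  have key : ∀ M ≤ N, (q + 1) * (q + 2) * D * ∑ W ∈ Finset.Icc 1 M, (S - y W) ^ 2 ≤ P (y M) := by
    intro M
    induction M with
    | zero =>
      intro _
      have h0 : y 0 ^ q = 0 := by simpa using hpow 0
      simp [hP, h0, pow_succ]
    | succ M ih =>
      intro hM
      rw [Finset.sum_Icc_succ_top (by omega), mul_add]
      have hle := hmono (Nat.le_add_right M 1)
      have h1 := mul_pow_mul_sq_le_pow_add (hy M) hle q
      have h1' := mul_le_mul_of_nonneg_left (mul_pow_mul_le_pow_add (hy M) (hy (M + 1)) q)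
        (sub_nonneg.2 ((hmono hM).trans hN))
      have h1'' := mul_le_mul_of_nonneg_left h1' (by positivity : (0 : ℝ) ≤ 2 * (q + 2))
      have h2 : D = y (M + 1) ^ q - y M ^ q := by
        rw [hpow, hpow]; push_cast; ring
      have h3 : (q + 1) * (q + 2) * D * (S - y (M + 1)) ^ 2 =
          (q + 1) * (q + 2) * (y (M + 1) ^ q - y M ^ q) * (S - y (M + 1)) ^ 2 := by rw [← h2]
      have h4 := ih (by omega)
      rw [h3]
      refine (add_le_add_left h4 _).trans ?_
      simp only [hP]
      ring_nf at h1 h1'' ⊢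
      linarith
  have h1 := mul_pow_mul_sq_le_pow_add (hy N) hN q
  have h2 := key N le_rfl
  simp only [hP] at h2
  linarith

theorem exists_branch_ge_of_forall_bound {T : JoinTree} {x : ℝ}
    (h : ∀ S : ℕ, BranchBound T S → x ≤ S) :
    ∃ b ∈ T.branches, ∃ L ⊆ b, ⌈x⌉₊ ≤ dvec L := by
  by_contra! hlt
  obtain ⟨b, hb⟩ := T.branches_ne_nil
  have h0 := hlt b hb [] (List.nil_subset _)
  have hx := h (⌈x⌉₊ - 1) fun b hb L hL => by have := hlt b hb L hL; omega
  have := Nat.ceil_le.2 hx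
  omega

theorem mul_rpow_inv_le_of_mul_pow_le {x z k : ℝ} {d : ℕ} (hd : d ≠ 0) (hx : 0 ≤ x) (hz : 0 ≤ z)
    (hk : 0 ≤ k) (h : k * x ^ d ≤ z ^ d) : x * k ^ (1 / (d : ℝ)) ≤ z := by
  refine (pow_le_pow_iff_left₀ (mul_nonneg hx (Real.rpow_nonneg hk _)) hz hd).1 ?_
  rw [mul_pow, one_div, Real.rpow_inv_natCast_pow hk hd, mul_comm]
  exact h

theorem one_add_inv_pow_le_exp {r : ℕ} (hr : r ≠ 0) :
    (((r : ℝ) + 1) / r) ^ r ≤ Real.exp 1 := by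
  have hr' : (r : ℝ) ≠ 0 := Nat.cast_ne_zero.2 hr
  have h1 : ((r : ℝ) + 1) / r ≤ Real.exp (1 / r) := by
    rw [add_div, div_self hr', add_comm]
    exact Real.add_one_le_exp _
  calc (((r : ℝ) + 1) / r) ^ r ≤ Real.exp (1 / r) ^ r := pow_le_pow_left₀ (by positivity) h1 _
    _ = Real.exp 1 := by rw [← Real.exp_nat_mul, mul_one_div_cancel hr']

theorem card_graph_le_of_leaf {G : PGraph} (h : (JoinTree.leaf G).valid) {c p : ℝ} {S d : ℕ}
    (hc : c ≤ 1) (hp : 0 ≤ p) :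
    c * d * (((JoinTree.leaf G).graph.card : ℝ)) ^ p - d ≤ S := by
  have h1 : (((JoinTree.leaf G).graph.card : ℝ)) ^ p ≤ 1 := by
    refine Real.rpow_le_one (Nat.cast_nonneg _) ?_ hp
    exact_mod_cast (show (JoinTree.leaf G).graph.card ≤ 1 from h)
  have h2 : c * d * (((JoinTree.leaf G).graph.card : ℝ)) ^ p ≤ 1 * d * 1 := by gcongr
  have h3 : (0 : ℝ) ≤ S := Nat.cast_nonneg S
  linarith

theorem card_graph_le_one_of_depth_zero {T : JoinTree} (h : SqDepthLE 0 T ∨ SemDepthLE 0 T)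
    (hv : T.valid) : T.graph.card ≤ 1 := by
  rcases h with h | h <;> cases h <;> exact hv

/-- A lower bound for the largest `Δ⃗` along the branches of a tree of small `[·]`-depth. -/
theorem le_branchBound_of_sqDepthLE {r : ℕ} {T : JoinTree} (hT : SqDepthLE (r + 1) T)
    (hv : T.valid) {S : ℕ} (hS : BranchBound T S) :
    (1 / (30 * Real.exp 1)) * ((r + 1 : ℕ) : ℝ) *
      (T.graph.card : ℝ) ^ (1 / ((r + 1 : ℕ) : ℝ)) - ((r + 1 : ℕ) : ℝ) ≤ S := by
  have he : 0 < Real.exp 1 := Real.exp_pos 1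
  have he1 : 1 ≤ Real.exp 1 := Real.one_le_exp zero_le_one
  set c := 1 / (30 * Real.exp 1) with hc
  have hc0 : 0 < c := by positivity
  have hc1 : c * Real.exp 1 = 1 / 30 := by rw [hc]; field_simp
  have hc2 : c ≤ 1 / 30 := by nlinarith
  induction r generalizing T S with
  | zero =>
    cases hT with
    | base _ G => exact card_graph_le_of_leaf hv (by linarith) (by positivity)
    | step _ m T h =>
      rcases (sqComb m T).graph.eq_empty_or_nonempty with hE | hE
      · rw [hE]
        have : (0 : ℝ) ≤ S := Nat.cast_nonneg S
        norm_num
        linarith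
      have hcard i : (T i).graph.card ≤ 1 :=
        card_graph_le_one_of_depth_zero (Or.inl (h i)) (valid_sqComb hv i)
      obtain ⟨n, hn, hle⟩ := card_maxSize_le (W := 1) (β := 0) le_rfl hS (fun j H _ _ => by
        obtain ⟨b, hb⟩ := ((T j).restrict H).branches_ne_nil
        exact ⟨b, hb, [], List.nil_subset _, Nat.zero_le _⟩) hE (fun e he => by
        rw [graph_sqComb, Finset.mem_biUnion] at he
        obtain ⟨i, -, hi⟩ := he
        have h1 : 1 ≤ maxSize T e := (Finset.card_pos.2 ⟨e, hi⟩).trans_le (card_le_maxSize hi)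
        obtain ⟨i', -, hi'⟩ := exists_card_eq_maxSize h1
        have := hcard i'
        omega)
      rw [add_zero] at hn
      subst hn
      have : ((sqComb m T).graph.card : ℝ) ≤ 12 * (S + 1) := by exact_mod_cast (by simpa using hle)
      norm_num
      nlinarith
  | succ r ih =>
    cases hT with
    | base _ G => exact card_graph_le_of_leaf hv (by linarith) (by positivity)
    | step _ m T h =>
      set E := (sqComb m T).graph with hEdef
      rcases E.eq_empty_or_nonempty with hE | hE
      · rw [hE]
        have : (0 : ℝ) ≤ S := Nat.cast_nonneg S
        have h0 : (1 / ((r + 1 + 1 : ℕ) : ℝ)) ≠ 0 := by positivity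
        rw [Finset.card_empty, Nat.cast_zero, Real.zero_rpow h0]
        have : (0 : ℝ) ≤ ((r + 1 + 1 : ℕ) : ℝ) := Nat.cast_nonneg _
        linarith
      set q : ℕ := r + 1 with hq
      have hq0 : q ≠ 0 := by omega
      set y : ℕ → ℝ := fun W => c * q * ((W : ℝ) / 2) ^ (1 / (q : ℝ)) with hy
      have hy0 : ∀ W, 0 ≤ y W := fun W => by positivity
      have hypow : ∀ W, y W ^ q = (c * q) ^ q / 2 * W := fun W => by
        simp only [hy]
        rw [mul_pow, one_div, Real.rpow_inv_natCast_pow (by positivity) hq0]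
        ring
      have hymono : Monotone y := fun W W' hW => by
        simp only [hy]
        gcongr
      have hβ : ∀ W, ∀ j, ∀ H ⊆ (T j).graph, W ≤ 2 * H.card →
          ∃ b ∈ ((T j).restrict H).branches, ∃ L ⊆ b, ⌈y W - q⌉₊ ≤ dvec L := by
        intro W j H hH hW
        refine exists_branch_ge_of_forall_bound fun S' hS' => ?_
        have := ih ((h j).restrict H) ((valid_sqComb hv j).restrict H) hS'
        rw [JoinTree.graph_restrict, Finset.inter_eq_right.2 hH] at this
        refine le_trans (sub_le_sub_right ?_ _) this
        have hW' : (W : ℝ) ≤ 2 * H.card := by exact_mod_cast hW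
        simp only [hy]
        gcongr
        linarith
      have hw : ∀ e ∈ E, 1 ≤ maxSize T e ∧ maxSize T e ≤ E.sup (maxSize T) := by
        intro e he
        refine ⟨?_, Finset.le_sup he⟩
        rw [hEdef, graph_sqComb, Finset.mem_biUnion] at he
        obtain ⟨i, -, hi⟩ := he
        exact (Finset.card_pos.2 ⟨e, hi⟩).trans_le (card_le_maxSize hi)
      set N := E.sup (maxSize T) with hN
      have hscale : ∀ W, 1 ≤ W → (E.filter fun e => W ≤ maxSize T e ∧ maxSize T e < 3 * W).Nonempty →
          y W ≤ S + (q + 1) ∧ ((E.filter fun e => W ≤ maxSize T e ∧ maxSize T e < 3 * W).card : ℝ) ≤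
            W * (12 * (S + (q + 1) - y W)) := by
        intro W hW hne
        obtain ⟨n, hn, hle⟩ := card_maxSize_le hW hS (hβ W) hne fun e he =>
          (Finset.mem_filter.1 he).2
        have h1 : (n : ℝ) ≤ S + (q + 1) - y W := by
          have h2 := Nat.le_ceil (y W - q)
          have h3 : (n : ℝ) + ⌈y W - q⌉₊ = S + 1 := by exact_mod_cast hn
          linarith
        have h0 : (0 : ℝ) ≤ n := Nat.cast_nonneg n
        refine ⟨by linarith, ?_⟩
        calc ((E.filter fun e => W ≤ maxSize T e ∧ maxSize T e < 3 * W).card : ℝ)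
            ≤ ((12 * W * n : ℕ) : ℝ) := by exact_mod_cast hle
          _ = W * (12 * n) := by push_cast; ring
          _ ≤ _ := by gcongr
      obtain ⟨e₀, he₀, he₀N⟩ := Finset.exists_mem_eq_sup E hE (maxSize T)
      have hyN : y N ≤ S + (q + 1) := by
        have h1 := (hw e₀ he₀).1
        refine (hscale N (by omega) ⟨e₀, Finset.mem_filter.2 ⟨he₀, ?_⟩⟩).1
        omega
      have hcardE := card_le_sum_of_scale_bound E (maxSize T) N hw
        (fun W => 12 * (S + (q + 1) - y W)) fun W hW => by
          obtain ⟨hW1, hWN⟩ := Finset.mem_Icc.1 hW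
          rcases (E.filter fun e => W ≤ maxSize T e ∧ maxSize T e < 3 * W).eq_empty_or_nonempty
            with h0 | hne
          · rw [h0, Finset.card_empty, Nat.cast_zero]
            have := hymono hWN
            exact mul_nonneg (Nat.cast_nonneg _) (by linarith)
          · exact (hscale W hW1 hne).2
      rw [← Finset.mul_sum] at hcardE
      have hsum := sum_sub_le_of_pow_eq (S := (S : ℝ) + (q + 1)) (by positivity) hy0 hypow N
      set A := ∑ W ∈ Finset.Icc 1 N, ((S : ℝ) + (q + 1) - y W)
      have hA0 : 0 ≤ A := by
        have : (0 : ℝ) ≤ E.card := Nat.cast_nonneg _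
        linarith
      rw [sub_le_iff_le_add]
      refine mul_rpow_inv_le_of_mul_pow_le (by omega) (by positivity) (by positivity)
        (by positivity) ?_
      have hexp := one_add_inv_pow_le_exp hq0
      have hq' : (q : ℝ) ≠ 0 := Nat.cast_ne_zero.2 hq0
      push_cast
      calc (E.card : ℝ) * (c * (q + 1)) ^ (q + 1)
          ≤ 6 / 5 * (12 * A) * (c * (q + 1)) ^ (q + 1) := by gcongr
        _ = 144 / 5 * (c * (((q : ℝ) + 1) / q) ^ q) * ((q + 1) * ((c * q) ^ q / 2) * A) := by
            rw [div_pow, mul_pow, mul_pow]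
            field_simp
            ring
        _ ≤ 144 / 5 * (c * Real.exp 1) * ((S : ℝ) + (q + 1)) ^ (q + 1) := by gcongr
        _ ≤ ((S : ℝ) + (q + 1)) ^ (q + 1) := by
            rw [hc1]
            have : 0 ≤ ((S : ℝ) + (q + 1)) ^ (q + 1) := by positivity
            linarith

theorem exists_semSeq {d m : ℕ} {T : Fin (m + 1) → JoinTree} (hv : (semComb m T).valid)
    (h : ∀ i, SemDepthLE d (T i)) :
    ∃ t : ℕ → JoinTree, semComb m T = semSeq m t ∧ ∀ j ≤ m, SemDepthLE d (t j) ∧ (t j).valid := by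
  refine ⟨fun i => if hi : i < m + 1 then T ⟨i, hi⟩ else .leaf ∅, semComb_eq_semSeq fun i => ?_,
    fun j hj => ?_⟩
  · rw [dif_pos i.2]
  · beta_reduce
    rw [dif_pos (Nat.lt_succ_of_le hj)]
    exact ⟨h _, valid_semComb hv _⟩

theorem one_le_birthSize {t : ℕ → JoinTree} {x : ℕ} {e : ℤ} (he : e ∈ graphBelow t x) :
    1 ≤ birthSize t e :=
  Finset.card_pos.2 ⟨e, self_mem_comp (birth_spec he).2⟩

/-- A lower bound for the largest `Δ⃗` along the branches of a tree of small `⟦·⟧`-depth. -/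
theorem le_branchBound_of_semDepthLE {r : ℕ} {T : JoinTree} (hT : SemDepthLE (r + 1) T)
    (hv : T.valid) {S : ℕ} (hS : BranchBound T S) :
    (1 / Real.sqrt (32 * Real.exp 1)) * ((r + 1 : ℕ) : ℝ) *
      (T.graph.card : ℝ) ^ (1 / ((2 * (r + 1) : ℕ) : ℝ)) - ((r + 1 : ℕ) : ℝ) ≤ S := by
  have he : 0 < Real.exp 1 := Real.exp_pos 1
  have he1 : 1 ≤ Real.exp 1 := Real.one_le_exp zero_le_one
  have he2 : Real.exp 1 < 2.8 := Real.exp_one_lt_d9.trans (by norm_num)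
  set c := 1 / Real.sqrt (32 * Real.exp 1) with hc
  have hc0 : 0 < c := by positivity
  have hc1 : c ^ 2 * Real.exp 1 = 1 / 32 := by
    rw [hc, div_pow, Real.sq_sqrt (by positivity)]
    field_simp
  have hc2 : c ^ 2 ≤ 1 / 32 := by nlinarith
  have hc3 : c ≤ 1 / 3 := by nlinarith
  clear_value c
  induction r generalizing T S with
  | zero =>
    cases hT with
    | base _ G => exact card_graph_le_of_leaf hv (by linarith) (by positivity)
    | step _ m T h =>
      obtain ⟨t, htT, ht⟩ := exists_semSeq hv h
      rw [htT] at hS ⊢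
      have hS0 : (0 : ℝ) ≤ S := Nat.cast_nonneg S
      rcases (semSeq m t).graph.eq_empty_or_nonempty with hE | hE
      · rw [hE]
        norm_num
        linarith
      obtain ⟨n, hn, hle⟩ := card_birthSize_le (W := 1) (β := 0) hS (fun j _ H _ _ => by
        obtain ⟨b, hb⟩ := ((t j).restrict H).branches_ne_nil
        exact ⟨b, hb, [], List.nil_subset _, Nat.zero_le _⟩) hE (fun e he => by
        rw [graph_semSeq] at he
        have h1 := Nat.lt_succ_iff.1 (birth_spec he).1
        have h2 : birthSize t e ≤ (t (birth t e)).graph.card := Finset.card_le_card (comp_subset _ _)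
        have h3 := card_graph_le_one_of_depth_zero (Or.inr (ht _ h1).1) (ht _ h1).2
        exact ⟨he, one_le_birthSize he, by omega⟩)
      rw [add_zero] at hn
      subst hn
      have h1 : ((semSeq m t).graph.card : ℝ) ≤ 9 * (S + 1) ^ 2 := by
        exact_mod_cast (by simpa using hle)
      rw [sub_le_iff_le_add]
      refine mul_rpow_inv_le_of_mul_pow_le (by norm_num) (by positivity) (by positivity)
        (by positivity) ?_
      norm_num
      calc ((semSeq m t).graph.card : ℝ) * c ^ 2 ≤ 9 * (S + 1) ^ 2 * (1 / 32) := by gcongr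
        _ ≤ ((S : ℝ) + 1) ^ 2 := by nlinarith [sq_nonneg ((S : ℝ) + 1)]
  | succ r ih =>
    cases hT with
    | base _ G => exact card_graph_le_of_leaf hv (by linarith) (by positivity)
    | step _ m T h =>
      obtain ⟨t, htT, ht⟩ := exists_semSeq hv h
      rw [htT] at hS ⊢
      set E := (semSeq m t).graph with hEdef
      rcases E.eq_empty_or_nonempty with hE | hE
      · rw [hE]
        have : (0 : ℝ) ≤ S := Nat.cast_nonneg S
        have h0 : (1 / ((2 * (r + 1 + 1) : ℕ) : ℝ)) ≠ 0 := by positivity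
        rw [Finset.card_empty, Nat.cast_zero, Real.zero_rpow h0]
        have : (0 : ℝ) ≤ ((r + 1 + 1 : ℕ) : ℝ) := Nat.cast_nonneg _
        linarith
      set q : ℕ := r + 1 with hq
      have hq0 : q ≠ 0 := by omega
      set y : ℕ → ℝ := fun W => c * q * (W : ℝ) ^ (1 / ((2 * q : ℕ) : ℝ)) with hy
      have hy0 : ∀ W, 0 ≤ y W := fun W => by positivity
      have hypow : ∀ W, y W ^ (2 * q) = (c * q) ^ (2 * q) * W := fun W => by
        simp only [hy]
        rw [mul_pow, one_div, Real.rpow_inv_natCast_pow (by positivity) (by omega)]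
      have hymono : Monotone y := fun W W' hW => by
        simp only [hy]
        gcongr
      have hβ : ∀ W, ∀ j ≤ m, ∀ H ⊆ (t j).graph, W ≤ H.card →
          ∃ b ∈ ((t j).restrict H).branches, ∃ L ⊆ b, ⌈y W - q⌉₊ ≤ dvec L := by
        intro W j hj H hH hW
        refine exists_branch_ge_of_forall_bound fun S' hS' => ?_
        have := ih ((ht j hj).1.restrict H) ((ht j hj).2.restrict H) hS'
        rw [JoinTree.graph_restrict, Finset.inter_eq_right.2 hH] at this
        refine le_trans (sub_le_sub_right ?_ _) this
        simp only [hy]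
        gcongr
      have hmem : ∀ {e}, e ∈ E → e ∈ graphBelow t (m + 1) := fun he => by
        rwa [hEdef, graph_semSeq] at he
      have hw : ∀ e ∈ E, 1 ≤ birthSize t e ∧ birthSize t e ≤ E.sup (birthSize t) :=
        fun e he => ⟨one_le_birthSize (hmem he), Finset.le_sup he⟩
      set N := E.sup (birthSize t) with hN
      have hscale : ∀ W,
          (E.filter fun e => W ≤ birthSize t e ∧ birthSize t e < 3 * W).Nonempty →
          y W ≤ S + (q + 1) ∧
          ((E.filter fun e => W ≤ birthSize t e ∧ birthSize t e < 3 * W).card : ℝ) ≤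
            W * (9 * (S + (q + 1) - y W) ^ 2) := by
        intro W hne
        obtain ⟨n, hn, hle⟩ := card_birthSize_le hS (hβ W) hne fun e he =>
          ⟨hmem (Finset.mem_filter.1 he).1, (Finset.mem_filter.1 he).2⟩
        have h1 : (n : ℝ) ≤ S + (q + 1) - y W := by
          have h2 := Nat.le_ceil (y W - q)
          have h3 : (n : ℝ) + ⌈y W - q⌉₊ = S + 1 := by exact_mod_cast hn
          linarith
        have h0 : (0 : ℝ) ≤ n := Nat.cast_nonneg n
        refine ⟨by linarith, ?_⟩
        calc ((E.filter fun e => W ≤ birthSize t e ∧ birthSize t e < 3 * W).card : ℝ)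
            ≤ ((9 * W * n ^ 2 : ℕ) : ℝ) := by exact_mod_cast hle
          _ = W * (9 * n ^ 2) := by push_cast; ring
          _ ≤ _ := by gcongr
      obtain ⟨e₀, he₀, he₀N⟩ := Finset.exists_mem_eq_sup E hE (birthSize t)
      have hyN : y N ≤ S + (q + 1) := by
        have h1 := (hw e₀ he₀).1
        refine (hscale N ⟨e₀, Finset.mem_filter.2 ⟨he₀, ?_⟩⟩).1
        omega
      have hcardE := card_le_sum_of_scale_bound E (birthSize t) N hw
        (fun W => 9 * (S + (q + 1) - y W) ^ 2) fun W _ => by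
          rcases (E.filter fun e => W ≤ birthSize t e ∧ birthSize t e < 3 * W).eq_empty_or_nonempty
            with h0 | hne
          · rw [h0, Finset.card_empty, Nat.cast_zero]
            positivity
          · exact (hscale W hne).2
      rw [← Finset.mul_sum] at hcardE
      have hsum := sum_sub_sq_le_of_pow_eq hy0 hymono hypow hyN
      set A := ∑ W ∈ Finset.Icc 1 N, ((S : ℝ) + (q + 1) - y W) ^ 2
      have hA0 : 0 ≤ A := Finset.sum_nonneg fun _ _ => sq_nonneg _
      rw [sub_le_iff_le_add]
      refine mul_rpow_inv_le_of_mul_pow_le (by omega) (by positivity) (by positivity)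
        (by positivity) ?_
      have hexp := one_add_inv_pow_le_exp hq0
      have hq' : (1 : ℝ) ≤ q := by exact_mod_cast Nat.one_le_iff_ne_zero.2 hq0
      have hqne : (q : ℝ) ≠ 0 := by positivity
      push_cast at hsum ⊢
      have hratio : ((q : ℝ) + 1) / (2 * q + 1) ≤ 2 / 3 := by
        rw [div_le_div_iff₀ (by positivity) (by positivity)]
        linarith
      set Z := (S : ℝ) + (q + 1)
      have hZ : 0 ≤ Z ^ (2 * q + 2) := by positivity
      have hR : 0 ≤ (((q : ℝ) + 1) / q) ^ q := by positivity
      rw [show 2 * (q + 1) = 2 * q + 2 by ring]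
      calc (E.card : ℝ) * (c * (q + 1)) ^ (2 * q + 2)
          ≤ 6 / 5 * (9 * A) * (c * (q + 1)) ^ (2 * q + 2) := by gcongr
        _ = 27 / 5 * (c ^ 2 * ((((q : ℝ) + 1) / q) ^ q * (((q : ℝ) + 1) / q) ^ q)) *
              (((q : ℝ) + 1) / (2 * q + 1)) *
              ((2 * q + 1) * (2 * q + 2) * (c * q) ^ (2 * q) * A) := by
            rw [← pow_add, ← two_mul, div_pow, mul_pow, mul_pow]
            field_simp
            ring
        _ ≤ 27 / 5 * (c ^ 2 * (Real.exp 1 * Real.exp 1)) * (2 / 3) * (2 * Z ^ (2 * q + 2)) := by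
            gcongr
        _ = 36 / 5 * (c ^ 2 * Real.exp 1) * Real.exp 1 * Z ^ (2 * q + 2) := by ring
        _ ≤ Z ^ (2 * q + 2) := by
            rw [hc1]
            nlinarith

section Pathset

variable {n ntil k : ℕ}

theorem isPathset_iff (hn : 0 < n) (hntil : 0 < ntil) {G : PGraph}
    {A : Finset (↥(verts G) → Fin n)} :
    IsPathset n ntil k G A ↔ ∀ F ⊆ pathk k, ∀ β : ↥(verts F) → Fin n,
      (A.filter fun α => ∀ (v : ℤ) (hG : v ∈ verts G) (hF : v ∈ verts F),
        α ⟨v, hG⟩ = β ⟨v, hF⟩).card * ntil ^ Delta (ominus G F) ≤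
          n ^ (verts G \ verts F).card := by
  have key (c d e : ℕ) :
      (c : ℝ) / (n : ℝ) ^ e ≤ (1 / (ntil : ℝ)) ^ d ↔ c * ntil ^ d ≤ n ^ e := by
    rw [one_div, inv_pow, ← one_div, div_le_div_iff₀ (by positivity) (by positivity), one_mul]
    exact_mod_cast Iff.rfl
  refine forall₂_congr fun F _ => ⟨fun h β => (key _ _ _).1 (le_trans ?_ h), fun h => ?_⟩
  · exact le_ciSup (f := fun β : ↥(verts F) → Fin n =>
      ((A.filter fun α => ∀ (v : ℤ) (hG : v ∈ verts G) (hF : v ∈ verts F),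
        α ⟨v, hG⟩ = β ⟨v, hF⟩).card : ℝ) / (n : ℝ) ^ (verts G \ verts F).card)
      (Set.finite_range _).bddAbove β
  · exact Real.iSup_le (fun β => (key _ _ _).2 (h β)) (by positivity)

theorem Delta_ominus_le_card (G F : PGraph) :
    Delta (ominus G F) ≤ (verts G \ verts F).card := by
  refine Finset.card_le_card fun i hi => ?_
  have hi := (Finset.mem_filter.1 hi).1
  rw [mem_ominus] at hi
  have h := hi.2 i (self_mem_comp hi.1)
  simp only [verts, Finset.mem_sdiff, Finset.mem_union, Finset.mem_image, not_or, not_exists,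
    not_and]
  refine ⟨Or.inl hi.1, fun hF => ?_, fun f hf hfi => ?_⟩
  · have := h i hF
    omega
  · have := h f hf
    omega

theorem isPathset_singleton (hntil : 0 < ntil) (hle : ntil ≤ n) {G : PGraph}
    (α : ↥(verts G) → Fin n) : IsPathset n ntil k G {α} := by
  rw [isPathset_iff (hntil.trans_le hle) hntil]
  intro F _ β
  calc _ ≤ 1 * n ^ Delta (ominus G F) := by
        gcongr
        exact (Finset.card_filter_le _ _).trans (Finset.card_singleton α).le
    _ ≤ n ^ (verts G \ verts F).card := by
        rw [one_mul]
        exact Nat.pow_le_pow_right (hntil.trans_le hle) (Delta_ominus_le_card G F)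

theorem verts_empty : verts ∅ = ∅ := rfl

theorem verts_union (F G : PGraph) : verts (F ∪ G) = verts F ∪ verts G := by
  simp only [verts, Finset.image_union]
  exact Finset.union_union_union_comm _ _ _ _

theorem isPathset_empty (hn : 0 < n) (hntil : 0 < ntil) (A : Finset (↥(verts ∅) → Fin n)) :
    IsPathset n ntil k ∅ A := by
  rw [isPathset_iff hn hntil]
  intro F _ β
  have h1 : ominus ∅ F = ∅ := Finset.subset_empty.1 (ominus_subset _ _)
  rw [h1, Delta_empty, pow_zero, mul_one]
  have : IsEmpty ↥(verts ∅) := ⟨fun v => Finset.notMem_empty _ v.2⟩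
  exact (Finset.card_le_one_of_subsingleton _).trans (Nat.one_le_pow _ _ hn)

/-- The restriction of a tuple to the vertices of a subgraph. -/
def restr {V : Finset ℤ} {G : PGraph} (h : verts G ⊆ V) (γ : ↥V → Fin n) : ↥(verts G) → Fin n :=
  fun v => γ ⟨v, h v.2⟩

/-- The restrictions of the tuples in `Γ` to the vertices of `C` lie in a common pathset. -/
def HasPathset (n ntil k : ℕ) {V : Finset ℤ} (Γ : Finset (↥V → Fin n)) (C : PGraph) : Prop :=
  ∃ (h : verts C ⊆ V) (P : Finset (↥(verts C) → Fin n)),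
    IsPathset n ntil k C P ∧ ∀ γ ∈ Γ, restr h γ ∈ P

theorem HasPathset.mono {V : Finset ℤ} {Γ Γ' : Finset (↥V → Fin n)} {C : PGraph}
    (h : HasPathset n ntil k Γ C) (hΓ : Γ' ⊆ Γ) : HasPathset n ntil k Γ' C := by
  obtain ⟨hC, P, hP, hΓP⟩ := h
  exact ⟨hC, P, hP, fun γ hγ => hΓP γ (hΓ hγ)⟩

theorem card_filter_agree_le {V W : Finset ℤ} (Γ : Finset (↥V → Fin n)) (β : ↥V → Fin n) :
    (Γ.filter fun γ => ∀ v : ↥V, v.1 ∈ W → γ v = β v).card ≤ n ^ (V \ W).card := by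
  have : n ^ (V \ W).card = (Finset.univ : Finset (↥(V \ W) → Fin n)).card := by
    simp
  rw [this]
  refine Finset.card_le_card_of_injOn (fun γ v => γ ⟨v, Finset.sdiff_subset v.2⟩)
    (fun _ _ => Finset.mem_coe.2 (Finset.mem_univ _)) fun γ hγ γ' hγ' h => funext fun v => ?_
  by_cases hv : v.1 ∈ W
  · rw [(Finset.mem_filter.1 hγ).2 v hv, (Finset.mem_filter.1 hγ').2 v hv]
  · exact congrFun h ⟨v, Finset.mem_sdiff.2 ⟨v.2, hv⟩⟩

/-- Chain rule: the density of a relation whose projections to the graphs in `L` are pathsets. -/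
theorem card_filter_agree_mul_pow_le (hn : 0 < n) (hntil : 0 < ntil) {V : Finset ℤ}
    (Γ : Finset (↥V → Fin n)) {L : List PGraph}
    (hL : ∀ C ∈ L, C ⊆ pathk k ∧ HasPathset n ntil k Γ C) {F : PGraph} (hF : F ⊆ pathk k)
    (hFV : verts F ⊆ V) (β : ↥V → Fin n) :
    (Γ.filter fun γ => ∀ v : ↥V, v.1 ∈ verts F → γ v = β v).card * ntil ^ dvecFrom F L ≤
      n ^ (V \ verts F).card := by
  induction L generalizing F β with
  | nil => simpa [dvecFrom] using card_filter_agree_le (W := verts F) Γ β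
  | cons C L ih =>
    obtain ⟨⟨hCk, hCV, P, hP, hΓP⟩, hL⟩ := List.forall_mem_cons.1 hL
    set S := Γ.filter fun γ => ∀ v : ↥V, v.1 ∈ verts F → γ v = β v with hS
    set Q := P.filter fun α => ∀ (v : ℤ) (hC : v ∈ verts C) (hv : v ∈ verts F),
      α ⟨v, hC⟩ = restr hFV β ⟨v, hv⟩ with hQ
    have hmaps : ∀ γ ∈ S, restr hCV γ ∈ Q := fun γ hγ => by
      rw [hS, Finset.mem_filter] at hγ
      exact Finset.mem_filter.2 ⟨hΓP γ hγ.1, fun v hC hv => hγ.2 ⟨v, hCV hC⟩ hv⟩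
    have hfiber : ∀ α ∈ Q, (S.filter fun γ => restr hCV γ = α).card * ntil ^ dvecFrom (F ∪ C) L ≤
        n ^ (V \ verts (F ∪ C)).card := by
      intro α _
      rcases (S.filter fun γ => restr hCV γ = α).eq_empty_or_nonempty with h0 | ⟨γ₀, hγ₀⟩
      · simp [h0]
      refine le_trans (Nat.mul_le_mul_right _ (Finset.card_le_card fun γ hγ => ?_))
        (ih hL (Finset.union_subset hF hCk)
          (by rw [verts_union]; exact Finset.union_subset hFV hCV) γ₀)
      simp only [hS, Finset.mem_filter] at hγ hγ₀ ⊢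
      refine ⟨hγ.1.1, fun v hv => ?_⟩
      rw [verts_union, Finset.mem_union] at hv
      rcases hv with hv | hv
      · rw [hγ.1.2 v hv, hγ₀.1.2 v hv]
      · exact congrFun (hγ.2.trans hγ₀.2.symm) ⟨v, hv⟩
    have hcardQ := (isPathset_iff hn hntil).1 hP F hF (restr hFV β)
    have hsize : (V \ verts F).card = (verts C \ verts F).card + (V \ verts (F ∪ C)).card := by
      rw [← Finset.card_union_of_disjoint]
      · congr 1
        ext v
        have := @hCV v
        simp only [verts_union, Finset.mem_sdiff, Finset.mem_union]
        tauto
      · rw [Finset.disjoint_left]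
        intro v
        simp only [verts_union, Finset.mem_sdiff, Finset.mem_union]
        tauto
    calc S.card * ntil ^ dvecFrom F (C :: L)
        = (∑ α ∈ Q, (S.filter fun γ => restr hCV γ = α).card * ntil ^ dvecFrom (F ∪ C) L) *
            ntil ^ Delta (ominus C F) := by
          rw [Finset.card_eq_sum_card_fiberwise hmaps, ← Finset.sum_mul, dvecFrom, pow_add]
          ring
      _ ≤ (Q.card * n ^ (V \ verts (F ∪ C)).card) * ntil ^ Delta (ominus C F) := by
          gcongr
          exact Finset.sum_le_card_nsmul _ _ _ hfiber
      _ = (Q.card * ntil ^ Delta (ominus C F)) * n ^ (V \ verts (F ∪ C)).card := by ring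
      _ ≤ n ^ (verts C \ verts F).card * n ^ (V \ verts (F ∪ C)).card := by gcongr
      _ = n ^ (V \ verts F).card := by rw [hsize, pow_add]

theorem card_mul_pow_dvec_le (hn : 0 < n) (hntil : 0 < ntil) {V : Finset ℤ}
    {Γ : Finset (↥V → Fin n)} {b₀ b L : List PGraph}
    (hb₀ : ∀ C ∈ b₀, C ⊆ pathk k ∧ HasPathset n ntil k Γ C)
    (hb : ∀ C ∈ b, C ⊆ pathk k ∧ HasPathset n ntil k Γ C) (hL : L ⊆ b₀ ++ b) {m : ℕ}
    (hm : 1 ≤ m) : Γ.card * ntil ^ dvec L ≤ m * n ^ V.card := by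
  have := card_filter_agree_mul_pow_le hn hntil Γ
    (fun C hC => (List.mem_append.1 (hL hC)).elim (hb₀ C) (hb C)) (Finset.empty_subset _)
    (Finset.empty_subset V) fun _ => ⟨0, hn⟩
  refine le_trans ?_ (Nat.le_mul_of_pos_left _ hm)
  simpa [verts_empty, dvec] using this

theorem chi_node_mem (hntil : 0 < ntil) (hle : ntil ≤ n) (T₁ T₂ : JoinTree)
    (A : Finset (↥(verts (T₁.graph ∪ T₂.graph)) → Fin n)) :
    chi n ntil k (.node T₁ T₂) A ∈ {s : ℕ | ∃ (r : ℕ) (Ai : Fin r → Finset (↥(verts (T₁.graph ∪ T₂.graph)) → Fin n))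
      (Bi : Fin r → Finset (↥(verts T₁.graph) → Fin n))
      (Ci : Fin r → Finset (↥(verts T₂.graph) → Fin n)),
      (∀ i, IsPathset n ntil k (T₁.graph ∪ T₂.graph) (Ai i)) ∧
      (∀ i, IsPathset n ntil k T₁.graph (Bi i)) ∧
      (∀ i, IsPathset n ntil k T₂.graph (Ci i)) ∧
      (∀ i, Ai i ⊆ joinRel n T₁.graph T₂.graph (Bi i) (Ci i)) ∧
      (A ⊆ Finset.univ.biUnion Ai) ∧
      s = ∑ i, max (chi n ntil k T₁ (Bi i)) (chi n ntil k T₂ (Ci i))} := by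
  erw [chi.eq_2]
  refine Nat.sInf_mem ⟨_, A.card, fun i => {(A.equivFin.symm i).1},
    fun i => {restr (verts_mono Finset.subset_union_left) (A.equivFin.symm i).1},
    fun i => {restr (verts_mono Finset.subset_union_right) (A.equivFin.symm i).1},
    fun _ => isPathset_singleton hntil hle _, fun _ => isPathset_singleton hntil hle _,
    fun _ => isPathset_singleton hntil hle _, fun i => ?_, fun α hα => ?_, rfl⟩
  · rw [Finset.singleton_subset_iff, joinRel, Finset.mem_filter]
    exact ⟨Finset.mem_univ _, Finset.mem_singleton_self _, Finset.mem_singleton_self _⟩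
  · refine Finset.mem_biUnion.2 ⟨A.equivFin ⟨α, hα⟩, Finset.mem_univ _, ?_⟩
    simp

theorem one_le_chi (hntil : 0 < ntil) (hle : ntil ≤ n) {T : JoinTree} (hT : T.graph.Nonempty)
    {A : Finset (↥(verts T.graph) → Fin n)} (hA : A.Nonempty) : 1 ≤ chi n ntil k T A := by
  induction T with
  | leaf G =>
    exact (if_neg (not_or.2 ⟨hT.ne_empty, hA.ne_empty⟩)).ge
  | node T₁ T₂ ih₁ ih₂ =>
    obtain ⟨r, Ai, Bi, Ci, -, -, -, hABC, hcover, hchi⟩ :=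
      chi_node_mem (k := k) hntil hle T₁ T₂ A
    obtain ⟨α, hα⟩ := hA
    obtain ⟨i, -, hi⟩ := Finset.mem_biUnion.1 (hcover hα)
    obtain ⟨-, hB, hC⟩ := Finset.mem_filter.1 (hABC i hi)
    rw [hchi]
    refine le_trans ?_ (Finset.single_le_sum (f := fun i => max (chi n ntil k T₁ (Bi i))
      (chi n ntil k T₂ (Ci i))) (fun _ _ => Nat.zero_le _) (Finset.mem_univ i))
    obtain ⟨e, he⟩ := hT
    rcases Finset.mem_union.1 he with he | he
    · exact le_max_of_le_left (ih₁ ⟨e, he⟩ ⟨_, hB⟩)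
    · exact le_max_of_le_right (ih₂ ⟨e, he⟩ ⟨_, hC⟩)

theorem card_mul_pow_dvec_le_of_chi_le (hntil : 0 < ntil) (hle : ntil ≤ n) {V : Finset ℤ}
    {T : JoinTree} (hTk : T.graph ⊆ pathk k) (hTV : verts T.graph ⊆ V)
    {A : Finset (↥(verts T.graph) → Fin n)} (hA : IsPathset n ntil k T.graph A)
    {Γ : Finset (↥V → Fin n)} (hΓA : ∀ γ ∈ Γ, restr hTV γ ∈ A) {b₀ b L : List PGraph}
    (hb₀ : ∀ C ∈ b₀, C ⊆ pathk k ∧ HasPathset n ntil k Γ C) (hb : b ∈ T.branches)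
    (hL : L ⊆ b₀ ++ b) {m : ℕ} (hm1 : 1 ≤ m) (hm : chi n ntil k T A ≤ m) :
    Γ.card * ntil ^ dvec L ≤ m * n ^ V.card := by
  have hn : 0 < n := hntil.trans_le hle
  induction T generalizing Γ b₀ b m with
  | leaf G =>
    rw [JoinTree.branches, List.mem_singleton] at hb
    refine card_mul_pow_dvec_le hn hntil hb₀ (fun C hC => ?_) hL hm1
    rw [hb, List.mem_singleton] at hC
    subst hC
    exact ⟨hTk, hTV, A, hA, hΓA⟩
  | node T₁ T₂ ih₁ ih₂ =>
    rcases (JoinTree.node T₁ T₂).graph.eq_empty_or_nonempty with h0 | hne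
    · refine card_mul_pow_dvec_le hn hntil hb₀ (fun C hC => ?_) hL hm1
      have hC0 : C = ∅ := Finset.subset_empty.1 (h0 ▸ JoinTree.subset_graph hb hC)
      subst hC0
      exact ⟨Finset.empty_subset _, Finset.empty_subset _, Finset.univ,
        isPathset_empty hn hntil _, fun _ _ => Finset.mem_univ _⟩
    have hk₁ : T₁.graph ⊆ pathk k := Finset.subset_union_left.trans hTk
    have hk₂ : T₂.graph ⊆ pathk k := Finset.subset_union_right.trans hTk
    have hV₁ : verts T₁.graph ⊆ V := (verts_mono Finset.subset_union_left).trans hTV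
    have hV₂ : verts T₂.graph ⊆ V := (verts_mono Finset.subset_union_right).trans hTV
    obtain ⟨r, Ai, Bi, Ci, -, hB, hC, hABC, hcover, hchi⟩ :=
      chi_node_mem (k := k) hntil hle T₁ T₂ A
    set Γi : Fin r → Finset (↥V → Fin n) := fun i => Γ.filter fun γ => restr hTV γ ∈ Ai i with hΓi
    have hsub i : Γi i ⊆ Γ := Finset.filter_subset _ _
    have hcard : Γ.card ≤ ∑ i, (Γi i).card := by
      refine le_trans (Finset.card_le_card fun γ hγ => ?_) Finset.card_biUnion_le
      obtain ⟨i, -, hi⟩ := Finset.mem_biUnion.1 (hcover (hΓA γ hγ))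
      exact Finset.mem_biUnion.2 ⟨i, Finset.mem_univ i, Finset.mem_filter.2 ⟨hγ, hi⟩⟩
    have hΓB i : ∀ γ ∈ Γi i, restr hV₁ γ ∈ Bi i ∧ restr hV₂ γ ∈ Ci i := fun γ hγ =>
      (Finset.mem_filter.1 (hABC i (Finset.mem_filter.1 hγ).2)).2
    have hpiece : ∀ i, (Γi i).card * ntil ^ dvec L ≤
        max (chi n ntil k T₁ (Bi i)) (chi n ntil k T₂ (Ci i)) * n ^ V.card := by
      intro i
      rcases (Γi i).eq_empty_or_nonempty with h0 | ⟨γ, hγ⟩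
      · simp [h0]
      have hmax : 1 ≤ max (chi n ntil k T₁ (Bi i)) (chi n ntil k T₂ (Ci i)) := by
        obtain ⟨e, he⟩ := hne
        rcases Finset.mem_union.1 he with he | he
        · exact le_max_of_le_left (one_le_chi hntil hle ⟨e, he⟩ ⟨_, (hΓB i γ hγ).1⟩)
        · exact le_max_of_le_right (one_le_chi hntil hle ⟨e, he⟩ ⟨_, (hΓB i γ hγ).2⟩)
      have hb₀i : ∀ C ∈ b₀, C ⊆ pathk k ∧ HasPathset n ntil k (Γi i) C := fun C hC =>
        ⟨(hb₀ C hC).1, (hb₀ C hC).2.mono (hsub i)⟩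
      rcases JoinTree.mem_branches_node.1 hb with ⟨b', hb', rfl⟩ | ⟨b', hb', rfl⟩
      · refine ih₁ hk₁ hV₁ (hB i) (fun γ hγ => (hΓB i γ hγ).1) (b₀ := b₀ ++ [T₂.graph])
          (fun D hD => ?_) hb' (by simpa using hL) hmax (le_max_left _ _)
        rcases List.mem_append.1 hD with hD | hD
        · exact hb₀i D hD
        · rw [List.mem_singleton.1 hD]
          exact ⟨hk₂, hV₂, Ci i, hC i, fun γ hγ => (hΓB i γ hγ).2⟩
      · refine ih₂ hk₂ hV₂ (hC i) (fun γ hγ => (hΓB i γ hγ).2) (b₀ := b₀ ++ [T₁.graph])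
          (fun D hD => ?_) hb' (by simpa using hL) hmax (le_max_right _ _)
        rcases List.mem_append.1 hD with hD | hD
        · exact hb₀i D hD
        · rw [List.mem_singleton.1 hD]
          exact ⟨hk₁, hV₁, Bi i, hB i, fun γ hγ => (hΓB i γ hγ).1⟩
    calc Γ.card * ntil ^ dvec L ≤ (∑ i, (Γi i).card) * ntil ^ dvec L := by gcongr
      _ ≤ ∑ i, max (chi n ntil k T₁ (Bi i)) (chi n ntil k T₂ (Ci i)) * n ^ V.card := by
          rw [Finset.sum_mul]
          exact Finset.sum_le_sum fun i _ => hpiece i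
      _ ≤ m * n ^ V.card := by
          rw [← Finset.sum_mul, ← hchi]
          gcongr

/-- Every list of graphs along a branch gives a lower bound on the pathset complexity. -/
theorem pow_dvec_mul_mu_le_chi (hntil : 0 < ntil) (hle : ntil ≤ n) {T : JoinTree}
    (hTk : T.graph ⊆ pathk k) (hT : T.graph.Nonempty) {A : Finset (↥(verts T.graph) → Fin n)}
    (hA : IsPathset n ntil k T.graph A) {b L : List PGraph} (hb : b ∈ T.branches) (hL : L ⊆ b) :
    (ntil : ℝ) ^ dvec L * mu n T.graph A ≤ chi n ntil k T A := by
  have hn : (0 : ℝ) < n := Nat.cast_pos.2 (hntil.trans_le hle)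
  rcases A.eq_empty_or_nonempty with h0 | hne
  · simp [mu, h0]
  have h := card_mul_pow_dvec_le_of_chi_le hntil hle hTk subset_rfl hA (Γ := A) (b₀ := [])
    (fun _ h => h) (by simp) hb hL (one_le_chi hntil hle hT hne) le_rfl
  rw [mu, ← mul_div_assoc, div_le_iff₀ (by positivity), mul_comm]
  exact_mod_cast h

theorem rpow_mul_mu_le_chi (hntil : 0 < ntil) (hle : ntil ≤ n) {T : JoinTree}
    (hTk : T.graph ⊆ pathk k) (hT : T.graph.Nonempty) {A : Finset (↥(verts T.graph) → Fin n)}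
    (hA : IsPathset n ntil k T.graph A) {x : ℝ} (hx : ∀ S : ℕ, BranchBound T S → x ≤ S) :
    (ntil : ℝ) ^ x * mu n T.graph A ≤ chi n ntil k T A := by
  obtain ⟨b, hb, L, hL, hxL⟩ := exists_branch_ge_of_forall_bound hx
  refine le_trans (mul_le_mul_of_nonneg_right ?_ (by rw [mu]; positivity))
    (pow_dvec_mul_mu_le_chi hntil hle hTk hT hA hb hL)
  rw [← Real.rpow_natCast]
  exact Real.rpow_le_rpow_of_exponent_le (by exact_mod_cast hntil) (Nat.ceil_le.1 hxL)

end Pathset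

/-- **Theorem 6.9 (pathset complexity tradeoffs).**  For every `Path_k`-join tree `T` and
every `Path_k`-pathset `A` (with respect to `n` and `ñ`):
(I)  `χ_T(A) ≥ ñ^{(1/(30e))·d·k^{1/d} − d} · μ(A)` where `d` is the `[·]`-depth of `T`;
(II) `χ_T(A) ≥ ñ^{(1/√(32e))·d·k^{1/(2d)} − d} · μ(A)` where `d` is the `⟦·⟧`-depth of `T`. -/
theorem pathset_complexity_tradeoffs (n ntil k : ℕ) (hn : 0 < n) (hntil : 0 < ntil)
    (hk : 2 ≤ k) (hle : ntil ≤ n) (T : JoinTree) (hval : T.valid) (hroot : T.graph = pathk k)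
    (A : Finset (↥(verts T.graph) → Fin n)) (hA : IsPathset n ntil k T.graph A)
    (d₁ : ℕ) (hd₁ : sqDepth T = d₁) (hd₁pos : 1 ≤ d₁)
    (d₂ : ℕ) (hd₂ : semDepth T = d₂) (hd₂pos : 1 ≤ d₂) :
    ((ntil : ℝ) ^ ((1 / (30 * Real.exp 1)) * d₁ * (k : ℝ) ^ (1 / (d₁ : ℝ)) - d₁) *
        mu n T.graph A ≤ (chi n ntil k T A : ℝ)) ∧
    ((ntil : ℝ) ^ ((1 / Real.sqrt (32 * Real.exp 1)) * d₂ * (k : ℝ) ^ (1 / (2 * (d₂ : ℝ))) - d₂) *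
        mu n T.graph A ≤ (chi n ntil k T A : ℝ)) := by
  have hcard : T.graph.card = k := by simp [hroot, pathk]
  have hne : T.graph.Nonempty := Finset.card_pos.1 (by omega)
  obtain ⟨r₁, rfl⟩ := Nat.exists_eq_add_of_le' hd₁pos
  obtain ⟨r₂, rfl⟩ := Nat.exists_eq_add_of_le' hd₂pos
  have h₁ : SqDepthLE (r₁ + 1) T :=
    hd₁ ▸ Nat.sInf_mem (s := {d | SqDepthLE d T}) (Nat.nonempty_of_pos_sInf (hd₁pos.trans_eq hd₁.symm))
  have h₂ : SemDepthLE (r₂ + 1) T :=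
    hd₂ ▸ Nat.sInf_mem (s := {d | SemDepthLE d T}) (Nat.nonempty_of_pos_sInf (hd₂pos.trans_eq hd₂.symm))
  refine ⟨rpow_mul_mu_le_chi hntil hle hroot.subset hne hA fun S hS => ?_,
    rpow_mul_mu_le_chi hntil hle hroot.subset hne hA fun S hS => ?_⟩
  · simpa only [hcard] using le_branchBound_of_sqDepthLE h₁ hval hS
  · have := le_branchBound_of_semDepthLE h₂ hval hS
    rwa [hcard, Nat.cast_mul, Nat.cast_ofNat] at this
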